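/- arXiv:0805.0521 — 4 statements merged into one kernel-verified Lean document; each statement's English description precedes it below -/
import Mathlib

section
/- For every σ > 0, E > 0, every free parameter β > 0 and every δ ≤ −σ/√e, the average-power-constrained capacity is upper-bounded as C(E) ≤ log( β·e^{−δ²/(2σ²)} + √(2π)·σ·Q(δ/σ) ) − log(√(2π)·σ) − δE/(2σ²) + (δ²/(2σ²))·( 1 − Q(δ/σ) − (E/δ)·Q(δ/σ) ) + (1/β)·( E + σ/√(2π) ). -/
open MeasureTheory ProbabilityTheory Real Filter Set
open scoped Classical Topology

/-- Kullback--Leibler divergence (in nats), valued in the extended reals: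
`D(P ∥ R) = ∫ log (dP/dR) dP` if `P ≪ R` and the log-likelihood ratio is
`P`-integrable, and `+∞` otherwise. -/
noncomputable def klDiv {α : Type*} [MeasurableSpace α] (P R : Measure α) : EReal :=
  if P ≪ R ∧ Integrable (llr P R) P then ((∫ x, llr P R x ∂P : ℝ) : EReal) else ⊤

/-- Joint law of `(X, Y)` where `X ~ Q` and `Y = X + Z` with `Z ~ N(0, σ²)`
independent of `X`. -/
noncomputable def jointLaw (σ : ℝ) (Q : Measure ℝ) : Measure (ℝ × ℝ) :=
  (Q.prod (gaussianReal 0 ⟨σ ^ 2, sq_nonneg σ⟩)).map (fun p => (p.1, p.1 + p.2))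

/-- Mutual information `I(X;Y)` in nats: the KL divergence of the joint law of
`(X, Y)` from the product of its marginal laws. -/
noncomputable def mutualInfo (σ : ℝ) (Q : Measure ℝ) : EReal :=
  klDiv (jointLaw σ Q) (((jointLaw σ Q).map Prod.fst).prod ((jointLaw σ Q).map Prod.snd))

/-- Capacity `C(E)` of the channel `Y = X + Z`, `Z ~ N(0, σ²)`, with only an
average-power constraint: `P(X ≥ 0) = 1` and `E[X] ≤ E`. -/
noncomputable def capacityAvg (σ E : ℝ) : EReal :=
  ⨆ Q ∈ {Q : Measure ℝ | IsProbabilityMeasure Q ∧ Q (Set.Ici 0) = 1 ∧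
      ∫⁻ x, ENNReal.ofReal x ∂Q ≤ ENNReal.ofReal E}, mutualInfo σ Q

/-- The Gaussian Q-function `Q(ξ) = ∫_ξ^∞ (1/√(2π)) e^{−t²/2} dt`. -/
noncomputable def Qf (ξ : ℝ) : ℝ := ∫ t in Set.Ioi ξ, (1 / Real.sqrt (2 * π)) * rexp (-t ^ 2 / 2)

noncomputable def vv (σ : ℝ) : NNReal := ⟨σ ^ 2, sq_nonneg σ⟩

lemma jointLaw_eq (σ : ℝ) (μ : Measure ℝ) : jointLaw σ μ =
    (μ.prod (gaussianReal 0 (vv σ))).map (fun p => (p.1, p.1 + p.2)) := rfl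

lemma vv_ne {σ : ℝ} (hσ : 0 < σ) : vv σ ≠ 0 := by
  intro h
  have h2 : ((vv σ : NNReal) : ℝ) = 0 := by rw [h]; rfl
  have h3 : σ ^ 2 = 0 := h2
  exact hσ.ne' (by simpa using h3)

lemma pdf_eq {σ : ℝ} (hσ : 0 < σ) (x y : ℝ) :
    gaussianPDFReal x (vv σ) y = (√(2 * π) * σ)⁻¹ * rexp (-(y - x) ^ 2 / (2 * σ ^ 2)) := by
  have : √(2 * π * σ ^ 2) = √(2 * π) * σ := by
    rw [Real.sqrt_mul (by positivity), Real.sqrt_sq hσ.le]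
  simp only [gaussianPDFReal]
  change (√(2 * π * σ ^ 2))⁻¹ * rexp (-(y - x) ^ 2 / (2 * σ ^ 2)) = _
  rw [this]

lemma Qf_eq (ξ : ℝ) : Qf ξ = (gaussianReal 0 1).real (Ioi ξ) := by
  rw [measureReal_def, gaussianReal_apply_eq_integral _ one_ne_zero, ENNReal.toReal_ofReal]
  · simp [Qf, gaussianPDFReal]
  · exact integral_nonneg fun _ => gaussianPDFReal_nonneg _ _ _

lemma G_Iio {σ : ℝ} (hσ : 0 < σ) (d : ℝ) :
    (gaussianReal 0 (vv σ)).real (Iio d) = Qf (-d / σ) := by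
  have h := gaussianReal_map_const_mul (μ := 0) (v := 1) (-σ)
  have h2 : gaussianReal (-σ * 0) (NNReal.mk ((-σ) ^ 2) (sq_nonneg _) * 1) = gaussianReal 0 (vv σ) := by
    congr 1
    · simp
    · apply NNReal.eq
      rw [NNReal.coe_mul]
      change (-σ) ^ 2 * 1 = σ ^ 2
      ring
  rw [h2] at h
  rw [Qf_eq, ← h, measureReal_def, Measure.map_apply (by fun_prop) measurableSet_Iio,
    measureReal_def]
  congr 2
  ext t
  simp only [mem_preimage, mem_Iio, mem_Ioi]
  rw [div_lt_iff₀ hσ]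
  constructor <;> intro h <;> linarith

lemma int_Iio {σ : ℝ} (hσ : 0 < σ) (d : ℝ) :
    IntegrableOn (fun y => rexp (-(y ^ 2 / (2 * σ ^ 2)))) (Iio d) ∧
    ∫ y in Iio d, rexp (-(y ^ 2 / (2 * σ ^ 2))) = √(2 * π) * σ * Qf (-d / σ) := by
  have hc : 0 < √(2 * π) * σ := by positivity
  have e : (fun y => rexp (-(y ^ 2 / (2 * σ ^ 2)))) =
      fun y => (√(2 * π) * σ) * gaussianPDFReal 0 (vv σ) y := by
    ext y
    rw [pdf_eq hσ, mul_inv_cancel_left₀ hc.ne']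
    congr 1; ring
  constructor
  · rw [e]
    exact ((integrable_gaussianPDFReal _ _).const_mul _).integrableOn
  · rw [e, integral_const_mul, ← G_Iio hσ, measureReal_def,
      gaussianReal_apply_eq_integral _ (vv_ne hσ), ENNReal.toReal_ofReal]
    exact integral_nonneg fun _ => gaussianPDFReal_nonneg _ _ _

noncomputable def psi (σ β d y : ℝ) : ℝ :=
  if y < d then y ^ 2 / (2 * σ ^ 2) else d ^ 2 / (2 * σ ^ 2) + (y - d) / β

lemma measurable_psi (σ β d : ℝ) : Measurable (psi σ β d) := by
  unfold psi
  exact Measurable.ite measurableSet_Iio (by fun_prop) (by fun_prop)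

lemma int_Ici {σ β : ℝ} (hβ : 0 < β) (d : ℝ) :
    IntegrableOn (fun y => rexp (-(d ^ 2 / (2 * σ ^ 2) + (y - d) / β))) (Ici d) ∧
    ∫ y in Ici d, rexp (-(d ^ 2 / (2 * σ ^ 2) + (y - d) / β)) =
      β * rexp (-d ^ 2 / (2 * σ ^ 2)) := by
  have e : (fun y => rexp (-(d ^ 2 / (2 * σ ^ 2) + (y - d) / β))) =
      fun y => rexp (-d ^ 2 / (2 * σ ^ 2) + d / β) * rexp ((-1 / β) * y) := by
    ext y
    rw [← Real.exp_add]; congr 1; ring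
  have hb : -1 / β < 0 := by rw [neg_div]; simpa using hβ
  rw [e, integrableOn_Ici_iff_integrableOn_Ioi, integral_Ici_eq_integral_Ioi]
  constructor
  · exact (integrableOn_exp_mul_Ioi hb d).const_mul _
  · rw [integral_const_mul, integral_exp_mul_Ioi hb, Real.exp_add]
    have : rexp (-1 / β * d) = (rexp (d / β))⁻¹ := by rw [← Real.exp_neg]; congr 1; ring
    rw [this]
    field_simp

lemma lint_psi {σ β : ℝ} (hσ : 0 < σ) (hβ : 0 < β) (d : ℝ) :
    ∫⁻ y, ENNReal.ofReal (rexp (-psi σ β d y)) =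
      ENNReal.ofReal (β * rexp (-d ^ 2 / (2 * σ ^ 2)) + √(2 * π) * σ * Qf (-d / σ)) := by
  have h1 := int_Iio hσ d
  have h2 := int_Ici (σ := σ) hβ d
  have e1 : ∀ y ∈ Iio d, rexp (-(y ^ 2 / (2 * σ ^ 2))) = rexp (-psi σ β d y) := by
    intro y hy
    simp only [mem_Iio] at hy
    simp [psi, hy]
  have e2 : ∀ y ∈ Ici d, rexp (-(d ^ 2 / (2 * σ ^ 2) + (y - d) / β)) = rexp (-psi σ β d y) := by
    intro y hy
    simp only [mem_Ici] at hy
    simp [psi, hy.not_gt]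
  rw [integrableOn_congr_fun e1 measurableSet_Iio, setIntegral_congr_fun measurableSet_Iio e1] at h1
  rw [integrableOn_congr_fun e2 measurableSet_Ici, setIntegral_congr_fun measurableSet_Ici e2] at h2
  have hi : Integrable (fun y => rexp (-psi σ β d y)) := by
    rw [← integrableOn_univ, ← Iio_union_Ici (a := d)]
    exact h1.1.union h2.1
  rw [← ofReal_integral_eq_lintegral_ofReal hi (Eventually.of_forall fun _ => (Real.exp_pos _).le)]
  congr 1
  rw [← integral_add_compl (measurableSet_Iio (a := d)) hi, compl_Iio, h1.2, h2.2]
  ring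

lemma G_pos_part {σ : ℝ} (hσ : 0 < σ) :
    ∫ z, max z 0 ∂(gaussianReal 0 (vv σ)) = σ / √(2 * π) := by
  rw [integral_gaussianReal_eq_integral_smul (vv_ne hσ)]
  have e : ∀ z, gaussianPDFReal 0 (vv σ) z • max z 0 =
      (Ioi (0:ℝ)).indicator (fun z => (√(2 * π) * σ)⁻¹ *
        (z ^ (1:ℝ) * rexp (-(1 / (2 * σ ^ 2)) * z ^ (2:ℝ)))) z := by
    intro z
    by_cases hz : 0 < z
    · rw [indicator_of_mem (by exact hz), pdf_eq hσ, max_eq_left hz.le, smul_eq_mul]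
      rw [Real.rpow_one, Real.rpow_two]
      have : -(z - 0) ^ 2 / (2 * σ ^ 2) = -(1 / (2 * σ ^ 2)) * z ^ 2 := by ring
      rw [this]; ring
    · rw [indicator_of_notMem (by exact hz), max_eq_right (not_lt.mp hz), smul_zero]
  simp_rw [e]
  rw [integral_indicator measurableSet_Ioi, integral_const_mul,
    integral_rpow_mul_exp_neg_mul_rpow (by norm_num) (by norm_num) (by positivity)]
  norm_num
  rw [Real.rpow_neg_one]
  field_simp

lemma psi_bound {σ β d x z : ℝ} (hσ : 0 < σ) (hβ : 0 < β) (hd : 0 < d) (hx : 0 ≤ x) :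
    psi σ β d (x + z) ≤ z ^ 2 / (2 * σ ^ 2) +
      (d ^ 2 / (2 * σ ^ 2) * (1 - (Iio d).indicator 1 z) +
        d / σ ^ 2 * (x * (Iio d).indicator 1 z)) + 1 / β * (x + max z 0) := by
  have h0 : 0 ≤ 1 / β * (x + max z 0) := by positivity
  have hm : z ≤ max z 0 := le_max_left _ _
  have hs : (0:ℝ) < 2 * σ ^ 2 := by positivity
  have h2 : (x + z - d) / β ≤ 1 / β * (x + max z 0) := by
    rw [div_eq_inv_mul, one_div]
    gcongr
    linarith
  have e : d / σ ^ 2 * x = 2 * d * x / (2 * σ ^ 2) := by field_simp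
  by_cases hz : z < d
  · rw [indicator_of_mem (by exact hz)]
    simp only [Pi.one_apply, sub_self, mul_zero, mul_one, zero_add, e]
    unfold psi
    split_ifs with h
    · have : (x + z) ^ 2 / (2 * σ ^ 2) ≤ (z ^ 2 + 2 * d * x) / (2 * σ ^ 2) := by
        gcongr
        nlinarith
      rw [add_div] at this
      linarith
    · have : d ^ 2 / (2 * σ ^ 2) ≤ (z ^ 2 + 2 * d * x) / (2 * σ ^ 2) := by
        gcongr
        nlinarith
      rw [add_div] at this
      linarith
  · rw [indicator_of_notMem (by exact hz)]
    have h : ¬ (x + z < d) := by linarith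
    simp only [psi, h, if_false, sub_zero, mul_zero, mul_one, add_zero]
    have : 0 ≤ z ^ 2 / (2 * σ ^ 2) := by positivity
    linarith

noncomputable def pden (σ : ℝ) (μ : Measure ℝ) (y : ℝ) : ENNReal :=
  ∫⁻ x, gaussianPDF x (vv σ) y ∂μ

lemma meas_w (σ : ℝ) : Measurable (fun q : ℝ × ℝ => gaussianPDF q.1 (vv σ) q.2) := by
  have := measurable_uncurry_gaussianPDF
  exact this.comp (f := fun q : ℝ × ℝ => (q.1, vv σ, q.2)) (by fun_prop)

lemma meas_wl (σ y : ℝ) : Measurable (fun x : ℝ => gaussianPDF x (vv σ) y) := by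
  have h : Measurable (fun x : ℝ => (x, y)) := by fun_prop
  have h2 := Measurable.comp (meas_w σ) h
  simpa only [Function.comp_def] using h2

lemma meas_pden (σ : ℝ) (μ : Measure ℝ) [IsProbabilityMeasure μ] : Measurable (pden σ μ) := by
  unfold pden
  exact (meas_w σ).lintegral_prod_left'

lemma w_le {σ : ℝ} (hσ : 0 < σ) (x y : ℝ) :
    gaussianPDF x (vv σ) y ≤ ENNReal.ofReal (√(2 * π) * σ)⁻¹ := by
  unfold gaussianPDF
  apply ENNReal.ofReal_le_ofReal
  rw [pdf_eq hσ]
  have h0 : 0 < √(2 * π) * σ := by positivity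
  apply mul_le_of_le_one_right (by positivity)
  rw [Real.exp_le_one_iff]
  rw [neg_div]
  have : 0 ≤ (y - x) ^ 2 / (2 * σ ^ 2) := by positivity
  linarith

lemma pden_le {σ : ℝ} (hσ : 0 < σ) (μ : Measure ℝ) [IsProbabilityMeasure μ] (y : ℝ) :
    pden σ μ y ≤ ENNReal.ofReal (√(2 * π) * σ)⁻¹ := by
  calc pden σ μ y ≤ ∫⁻ x, ENNReal.ofReal (√(2 * π) * σ)⁻¹ ∂μ := lintegral_mono fun x => w_le hσ x y
    _ = _ := by simp

lemma pden_ne_top {σ : ℝ} (hσ : 0 < σ) (μ : Measure ℝ) [IsProbabilityMeasure μ] (y : ℝ) :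
    pden σ μ y ≠ ⊤ := ((pden_le hσ μ y).trans_lt ENNReal.ofReal_lt_top).ne

lemma pden_ne_zero {σ : ℝ} (hσ : 0 < σ) (μ : Measure ℝ) [IsProbabilityMeasure μ] (y : ℝ) :
    pden σ μ y ≠ 0 := by
  unfold pden
  intro h
  rw [lintegral_eq_zero_iff (meas_wl σ y)] at h
  have : ∀ᵐ x ∂μ, False := by
    filter_upwards [h] with x hx
    exact (gaussianPDF_pos x (vv_ne hσ) y).ne' hx
  simp at this
  exact IsProbabilityMeasure.ne_zero μ this

lemma lint_joint {σ : ℝ} (hσ : 0 < σ) (μ : Measure ℝ) [IsProbabilityMeasure μ]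
    {F : ℝ × ℝ → ENNReal} (hF : Measurable F) :
    ∫⁻ q, F q ∂(jointLaw σ μ) = ∫⁻ x, ∫⁻ y, F (x, y) * gaussianPDF x (vv σ) y ∂volume ∂μ := by
  rw [jointLaw_eq]
  rw [lintegral_map hF (by fun_prop), lintegral_prod _ (by fun_prop)]
  apply lintegral_congr
  intro x
  have h := gaussianReal_map_const_add (μ := 0) (v := vv σ) x
  rw [zero_add] at h
  have h1 : ∫⁻ z, F (x, x + z) ∂(gaussianReal 0 (vv σ)) = ∫⁻ y, F (x, y) ∂(gaussianReal x (vv σ)) := by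
    rw [← h, lintegral_map (by fun_prop) (by fun_prop)]
  refine h1.trans ?_
  rw [gaussianReal_of_var_ne_zero _ (vv_ne hσ),
    lintegral_withDensity_eq_lintegral_mul _ (measurable_gaussianPDF _ _) (by fun_prop)]
  simp [mul_comm]

lemma lint_snd {σ : ℝ} (hσ : 0 < σ) (μ : Measure ℝ) [IsProbabilityMeasure μ]
    {g : ℝ → ENNReal} (hg : Measurable g) :
    ∫⁻ y, g y ∂((jointLaw σ μ).map Prod.snd) = ∫⁻ y, g y * pden σ μ y := by
  rw [lintegral_map hg measurable_snd, lint_joint hσ μ (F := fun q => g q.2) (by fun_prop)]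
  rw [lintegral_lintegral_swap]
  · apply lintegral_congr
    intro y
    change ∫⁻ x, g y * gaussianPDF x (vv σ) y ∂μ = _
    rw [lintegral_const_mul]
    · rfl
    · exact meas_wl σ y
  · exact ((hg.comp measurable_snd).mul (meas_w σ)).aemeasurable

lemma map_fst (σ : ℝ) (μ : Measure ℝ) [IsProbabilityMeasure μ] :
    (jointLaw σ μ).map Prod.fst = μ := by
  rw [jointLaw_eq]
  rw [Measure.map_map measurable_fst (by fun_prop)]
  change Measure.map Prod.fst _ = μ
  simp

instance prob_joint (σ : ℝ) (μ : Measure ℝ) [IsProbabilityMeasure μ] :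
    IsProbabilityMeasure (jointLaw σ μ) := by
  rw [jointLaw_eq]
  exact Measure.isProbabilityMeasure_map (by fun_prop)

instance prob_snd (σ : ℝ) (μ : Measure ℝ) [IsProbabilityMeasure μ] :
    IsProbabilityMeasure ((jointLaw σ μ).map Prod.snd) :=
  Measure.isProbabilityMeasure_map (by fun_prop)

noncomputable def rat (σ : ℝ) (μ : Measure ℝ) (q : ℝ × ℝ) : ENNReal :=
  gaussianPDF q.1 (vv σ) q.2 / pden σ μ q.2

lemma meas_rat (σ : ℝ) (μ : Measure ℝ) [IsProbabilityMeasure μ] : Measurable (rat σ μ) := by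
  unfold rat
  exact (meas_w σ).div ((meas_pden σ μ).comp measurable_snd)

lemma joint_eq {σ : ℝ} (hσ : 0 < σ) (μ : Measure ℝ) [IsProbabilityMeasure μ] :
    jointLaw σ μ = (((jointLaw σ μ).map Prod.fst).prod ((jointLaw σ μ).map Prod.snd)).withDensity
      (rat σ μ) := by
  rw [map_fst]
  have hr := meas_rat σ μ
  ext A hA
  rw [withDensity_apply _ hA, ← lintegral_indicator hA, lintegral_prod _ (by fun_prop),
    ← lintegral_indicator_one hA, lint_joint hσ μ (by fun_prop)]
  apply lintegral_congr
  intro x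
  rw [lint_snd hσ μ (g := fun y => A.indicator (rat σ μ) (x, y))
    ((hr.indicator hA).comp (by fun_prop : Measurable fun y : ℝ => (x, y)))]
  apply lintegral_congr
  intro y
  by_cases h : (x, y) ∈ A
  · rw [indicator_of_mem h, indicator_of_mem h]
    simp only [rat, Pi.one_apply, one_mul]
    rw [ENNReal.div_mul_cancel (pden_ne_zero hσ μ y) (pden_ne_top hσ μ y)]
  · rw [indicator_of_notMem h, indicator_of_notMem h]; simp

lemma ac_joint {σ : ℝ} (hσ : 0 < σ) (μ : Measure ℝ) [IsProbabilityMeasure μ] :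
    jointLaw σ μ ≪ ((jointLaw σ μ).map Prod.fst).prod ((jointLaw σ μ).map Prod.snd) := by
  conv_lhs => rw [joint_eq hσ μ]
  exact withDensity_absolutelyContinuous _ _

/-- the log-likelihood ratio in terms of the noise -/
noncomputable def lr (σ : ℝ) (μ : Measure ℝ) (q : ℝ × ℝ) : ℝ :=
  - Real.log (√(2 * π) * σ) - (q.2 - q.1) ^ 2 / (2 * σ ^ 2) - Real.log (pden σ μ q.2).toReal

lemma meas_lr (σ : ℝ) (μ : Measure ℝ) [IsProbabilityMeasure μ] : Measurable (lr σ μ) := by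
  have := meas_pden σ μ
  unfold lr
  fun_prop

lemma llr_ae {σ : ℝ} (hσ : 0 < σ) (μ : Measure ℝ) [IsProbabilityMeasure μ] :
    llr (jointLaw σ μ) (((jointLaw σ μ).map Prod.fst).prod ((jointLaw σ μ).map Prod.snd))
      =ᵐ[jointLaw σ μ] lr σ μ := by
  have h := Measure.rnDeriv_withDensity
    (((jointLaw σ μ).map Prod.fst).prod ((jointLaw σ μ).map Prod.snd)) (meas_rat σ μ)
  rw [← joint_eq hσ μ] at h
  rw [map_fst] at h
  have hac := ac_joint hσ μ
  rw [map_fst] at hac ⊢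
  filter_upwards [hac.ae_le h] with q hq
  have h0 : 0 < √(2 * π) * σ := by positivity
  rw [llr, hq, rat, ENNReal.toReal_div, toReal_gaussianPDF, pdf_eq hσ, Real.log_div, Real.log_mul,
    Real.log_inv, Real.log_exp, lr]
  · ring
  · positivity
  · positivity
  · positivity
  · exact ENNReal.toReal_ne_zero.mpr ⟨pden_ne_zero hσ μ _, pden_ne_top hσ μ _⟩

noncomputable def kk (σ β d N : ℝ) (μ : Measure ℝ) (y : ℝ) : ℝ :=
  rexp (-psi σ β d y) / (N * (pden σ μ y).toReal)

lemma pden_toReal_pos {σ : ℝ} (hσ : 0 < σ) (μ : Measure ℝ) [IsProbabilityMeasure μ] (y : ℝ) :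
    0 < (pden σ μ y).toReal := ENNReal.toReal_pos (pden_ne_zero hσ μ y) (pden_ne_top hσ μ y)

lemma kk_int {σ β d N : ℝ} (hσ : 0 < σ) (hβ : 0 < β) (hN : 0 < N)
    (hNe : N = β * rexp (-d ^ 2 / (2 * σ ^ 2)) + √(2 * π) * σ * Qf (-d / σ))
    (μ : Measure ℝ) [IsProbabilityMeasure μ] :
    Integrable (fun p : ℝ × ℝ => kk σ β d N μ (p.1 + p.2)) (μ.prod (gaussianReal 0 (vv σ))) ∧
    ∫ p, kk σ β d N μ (p.1 + p.2) ∂(μ.prod (gaussianReal 0 (vv σ))) = 1 := by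
  have hmp := meas_pden σ μ
  have hms := measurable_psi σ β d
  have hmk : Measurable (kk σ β d N μ) := by unfold kk; fun_prop
  have hk0 : ∀ y, 0 ≤ kk σ β d N μ y := fun y =>
    div_nonneg (Real.exp_pos _).le (mul_nonneg hN.le ENNReal.toReal_nonneg)
  have hl : ∫⁻ p, ENNReal.ofReal (kk σ β d N μ (p.1 + p.2)) ∂(μ.prod (gaussianReal 0 (vv σ))) = 1 := by
    have h := lint_snd hσ μ (g := fun y => ENNReal.ofReal (kk σ β d N μ y)) (by fun_prop)
    rw [lintegral_map (by fun_prop) measurable_snd, jointLaw_eq,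
      lintegral_map (by fun_prop) (by fun_prop)] at h
    refine h.trans ?_
    have e : ∀ y, ENNReal.ofReal (kk σ β d N μ y) * pden σ μ y =
        ENNReal.ofReal N⁻¹ * ENNReal.ofReal (rexp (-psi σ β d y)) := by
      intro y
      have hp := pden_toReal_pos hσ μ y
      rw [← ENNReal.ofReal_toReal (pden_ne_top hσ μ y), ← ENNReal.ofReal_mul (hk0 y),
        ← ENNReal.ofReal_mul (by positivity)]
      congr 1
      unfold kk
      field_simp
    simp_rw [e]
    rw [lintegral_const_mul _ (by fun_prop), lint_psi hσ hβ, ← hNe,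
      ← ENNReal.ofReal_mul (by positivity), inv_mul_cancel₀ hN.ne', ENNReal.ofReal_one]
  have hm : Measurable (fun p : ℝ × ℝ => kk σ β d N μ (p.1 + p.2)) := by fun_prop
  constructor
  · refine ⟨hm.aestronglyMeasurable, ?_⟩
    rw [hasFiniteIntegral_iff_ofReal (Eventually.of_forall fun p => hk0 _), hl]
    exact ENNReal.one_lt_top
  · rw [integral_eq_lintegral_of_nonneg_ae (Eventually.of_forall fun p => hk0 _)
      hm.aestronglyMeasurable, hl]
    rfl

lemma lr_lower {σ : ℝ} (hσ : 0 < σ) (μ : Measure ℝ) [IsProbabilityMeasure μ] (x z : ℝ) :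
    -(z ^ 2 / (2 * σ ^ 2)) ≤ lr σ μ (x, x + z) := by
  have hp := pden_toReal_pos hσ μ (x + z)
  have h0 : 0 < √(2 * π) * σ := by positivity
  have h1 : (pden σ μ (x + z)).toReal ≤ (√(2 * π) * σ)⁻¹ :=
    ENNReal.toReal_le_of_le_ofReal (by positivity) (pden_le hσ μ _)
  have h2 := Real.log_le_log hp h1
  rw [Real.log_inv] at h2
  simp only [lr, add_sub_cancel_left]
  linarith

lemma lr_upper {σ β d N x z : ℝ} (hσ : 0 < σ) (hβ : 0 < β) (hd : 0 < d) (hN : 0 < N)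
    (hx : 0 ≤ x) (μ : Measure ℝ) [IsProbabilityMeasure μ] :
    lr σ μ (x, x + z) ≤ Real.log N - Real.log (√(2 * π) * σ) - 1 +
      (d ^ 2 / (2 * σ ^ 2) * (1 - (Iio d).indicator 1 z) +
        d / σ ^ 2 * (x * (Iio d).indicator 1 z)) + 1 / β * (x + max z 0) +
        kk σ β d N μ (x + z) := by
  have hp := pden_toReal_pos hσ μ (x + z)
  have hb := psi_bound (z := z) hσ hβ hd hx
  have ht : 0 < (pden σ μ (x + z)).toReal * N * rexp (psi σ β d (x + z)) := by positivity
  have h1 := Real.one_sub_inv_le_log_of_pos ht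
  rw [Real.log_mul (by positivity) (by positivity), Real.log_mul hp.ne' hN.ne', Real.log_exp] at h1
  have e : ((pden σ μ (x + z)).toReal * N * rexp (psi σ β d (x + z)))⁻¹ = kk σ β d N μ (x + z) := by
    unfold kk
    rw [Real.exp_neg]
    field_simp
  rw [e] at h1
  simp only [lr, add_sub_cancel_left]
  linarith

lemma main_bound {σ E β d : ℝ} (hσ : 0 < σ) (hE : 0 < E) (hβ : 0 < β) (hd : 0 < d)
    (μ : Measure ℝ) [IsProbabilityMeasure μ] (hpos : μ (Set.Ici 0) = 1)
    (hmean : ∫⁻ x, ENNReal.ofReal x ∂μ ≤ ENNReal.ofReal E) :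
    mutualInfo σ μ ≤ ((Real.log (β * rexp (-d ^ 2 / (2 * σ ^ 2)) + √(2 * π) * σ * Qf (-d / σ))
        - Real.log (√(2 * π) * σ) + d ^ 2 / (2 * σ ^ 2) * (1 - Qf (-d / σ))
        + d / σ ^ 2 * (E * Qf (-d / σ)) + 1 / β * (E + σ / √(2 * π)) : ℝ) : EReal) := by
  obtain ⟨N, hNe⟩ : ∃ N, N = β * rexp (-d ^ 2 / (2 * σ ^ 2)) + √(2 * π) * σ * Qf (-d / σ) := ⟨_, rfl⟩
  have hQ0 : 0 ≤ Qf (-d / σ) := by rw [Qf_eq]; exact measureReal_nonneg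
  have hN : 0 < N := by rw [hNe]; positivity
  rw [← hNe]
  set G := gaussianReal 0 (vv σ) with hG
  have hx0 : ∀ᵐ x ∂μ, 0 ≤ x := by
    have := (prob_compl_eq_zero_iff (μ := μ) (measurableSet_Ici (a := (0:ℝ)))).mpr hpos
    exact this
  have hxi : Integrable (fun x : ℝ => x) μ := by
    refine ⟨measurable_id.aestronglyMeasurable, ?_⟩
    rw [hasFiniteIntegral_iff_ofReal hx0]
    exact hmean.trans_lt ENNReal.ofReal_lt_top
  have hxE : ∫ x, x ∂μ ≤ E := by
    rw [integral_eq_lintegral_of_nonneg_ae hx0 measurable_id.aestronglyMeasurable]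
    exact ENNReal.toReal_le_of_le_ofReal hE.le hmean
  have hz1 : Integrable (fun z : ℝ => z) G := (memLp_id_gaussianReal 1).integrable (by simp)
  have hz2 : Integrable (fun z : ℝ => z ^ 2) G := (memLp_id_gaussianReal 2).integrable_sq
  have hind : Integrable ((Iio d).indicator (1 : ℝ → ℝ)) G :=
    (integrable_const (1:ℝ)).indicator measurableSet_Iio
  have hindv : ∫ z, (Iio d).indicator (1 : ℝ → ℝ) z ∂G = Qf (-d / σ) := by
    rw [integral_indicator_one measurableSet_Iio, hG, G_Iio hσ]
  obtain ⟨hki, hkv⟩ := kk_int hσ hβ hN hNe μ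
  rw [← hG] at hki hkv
  have hx0' : ∀ᵐ p ∂(μ.prod G), 0 ≤ p.1 := Measure.quasiMeasurePreserving_fst.ae hx0
  have i1 : Integrable (fun p : ℝ × ℝ => (Iio d).indicator (1 : ℝ → ℝ) p.2) (μ.prod G) :=
    hind.comp_snd μ
  have v1 : ∫ p, (Iio d).indicator (1 : ℝ → ℝ) p.2 ∂(μ.prod G) = Qf (-d / σ) := by
    rw [integral_fun_snd (μ := μ) (ν := G) (fun z => (Iio d).indicator (1 : ℝ → ℝ) z), hindv]; simp
  have i2 : Integrable (fun p : ℝ × ℝ => p.1 * (Iio d).indicator (1 : ℝ → ℝ) p.2) (μ.prod G) :=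
    hxi.mul_prod hind
  have v2 : ∫ p, p.1 * (Iio d).indicator (1 : ℝ → ℝ) p.2 ∂(μ.prod G) =
      (∫ x, x ∂μ) * Qf (-d / σ) := by
    rw [integral_prod_mul (μ := μ) (ν := G) (fun x => x) (fun z => (Iio d).indicator (1 : ℝ → ℝ) z), hindv]
  have i3 : Integrable (fun p : ℝ × ℝ => p.1) (μ.prod G) := hxi.comp_fst G
  have v3 : ∫ p, p.1 ∂(μ.prod G) = ∫ x, x ∂μ := by
    rw [integral_fun_fst (μ := μ) (ν := G) (fun x => x)]; simp
  have i4 : Integrable (fun p : ℝ × ℝ => max p.2 0) (μ.prod G) := (hz1.pos_part).comp_snd μ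
  have v4 : ∫ p, max p.2 0 ∂(μ.prod G) = σ / √(2 * π) := by
    rw [integral_fun_snd (μ := μ) (ν := G) (fun z => max z 0), hG, G_pos_part hσ]; simp
  have i5 : Integrable (fun p : ℝ × ℝ => p.2 ^ 2) (μ.prod G) := hz2.comp_snd μ
  set U : ℝ × ℝ → ℝ := fun p => Real.log N - Real.log (√(2 * π) * σ) - 1 +
      (d ^ 2 / (2 * σ ^ 2) * (1 - (Iio d).indicator 1 p.2) +
        d / σ ^ 2 * (p.1 * (Iio d).indicator 1 p.2)) + 1 / β * (p.1 + max p.2 0) +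
        kk σ β d N μ (p.1 + p.2) with hU
  have j1 := ((integrable_const (1:ℝ)).sub i1).const_mul (d ^ 2 / (2 * σ ^ 2))
  have j2 := i2.const_mul (d / σ ^ 2)
  have j3 := (i3.add i4).const_mul (1 / β)
  have jc : Integrable (fun _ : ℝ × ℝ => Real.log N - Real.log (√(2 * π) * σ) - 1) (μ.prod G) :=
    integrable_const _
  have hUi : Integrable U (μ.prod G) := ((jc.add (j1.add j2)).add j3).add hki
  have hUv : ∫ p, U p ∂(μ.prod G) = Real.log N - Real.log (√(2 * π) * σ) - 1 +
      (d ^ 2 / (2 * σ ^ 2) * (1 - Qf (-d / σ)) + d / σ ^ 2 * ((∫ x, x ∂μ) * Qf (-d / σ))) +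
      1 / β * ((∫ x, x ∂μ) + σ / √(2 * π)) + 1 := by
    rw [hU]
    have a1 := integral_add ((jc.add (j1.add j2)).add j3) hki
    have a2 := integral_add (jc.add (j1.add j2)) j3
    have a3 := integral_add jc (j1.add j2)
    have a4 := integral_add j1 j2
    have a5 := integral_add i3 i4
    have a6 := integral_sub (integrable_const (1:ℝ)) i1
    simp only [Pi.add_apply, Pi.sub_apply, integral_const_mul] at a1 a2 a3 a4 a5 a6
    rw [a1, a2, a3, a4, a5, a6, hkv, v1, v2, v3, v4]
    simp
  have hT : Measurable (fun p : ℝ × ℝ => (p.1, p.1 + p.2)) := by fun_prop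
  have hlm := meas_lr σ μ
  have hlri : Integrable (fun p : ℝ × ℝ => lr σ μ (p.1, p.1 + p.2)) (μ.prod G) := by
    refine integrable_of_le_of_le (g₁ := fun p => -(p.2 ^ 2 / (2 * σ ^ 2))) (g₂ := U)
      (hlm.comp hT).aestronglyMeasurable ?_ ?_ ?_ hUi
    · exact Eventually.of_forall fun p => lr_lower hσ μ p.1 p.2
    · filter_upwards [hx0'] with p hp
      exact lr_upper hσ hβ hd hN hp μ
    · exact (i5.div_const _).neg
  have hlrv : ∫ p, lr σ μ (p.1, p.1 + p.2) ∂(μ.prod G) ≤ ∫ p, U p ∂(μ.prod G) := by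
    apply integral_mono_ae hlri hUi
    filter_upwards [hx0'] with p hp
    exact lr_upper hσ hβ hd hN hp μ
  have hlJ : Integrable (lr σ μ) (jointLaw σ μ) := by
    rw [jointLaw_eq, integrable_map_measure hlm.aestronglyMeasurable hT.aemeasurable]
    exact hlri
  have hvJ : ∫ q, lr σ μ q ∂(jointLaw σ μ) = ∫ p, lr σ μ (p.1, p.1 + p.2) ∂(μ.prod G) := by
    rw [jointLaw_eq, integral_map hT.aemeasurable hlm.aestronglyMeasurable]
  have hll := llr_ae hσ μ
  unfold mutualInfo klDiv
  rw [if_pos ⟨ac_joint hσ μ, (integrable_congr hll).mpr hlJ⟩, integral_congr_ae hll, hvJ]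
  rw [EReal.coe_le_coe_iff]
  refine hlrv.trans ?_
  rw [hUv]
  have g1 : d / σ ^ 2 * ((∫ x, x ∂μ) * Qf (-d / σ)) ≤ d / σ ^ 2 * (E * Qf (-d / σ)) := by gcongr
  have g2 : 1 / β * ((∫ x, x ∂μ) + σ / √(2 * π)) ≤ 1 / β * (E + σ / √(2 * π)) := by gcongr
  linarith

/-- Duality-based upper bound on the average-power-constrained capacity, with
free parameters `β > 0` and `δ ≤ −σ/√e`. -/
theorem capacityAvg_upper_bound_low (σ E β δ : ℝ) (hσ : 0 < σ) (hE : 0 < E)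
    (hβ : 0 < β) (hδ : δ ≤ -(σ / Real.sqrt (rexp 1))) :
    capacityAvg σ E ≤
      ((Real.log (β * rexp (-δ ^ 2 / (2 * σ ^ 2)) + Real.sqrt (2 * π) * σ * Qf (δ / σ))
        - Real.log (Real.sqrt (2 * π) * σ)
        - δ * E / (2 * σ ^ 2)
        + δ ^ 2 / (2 * σ ^ 2) * (1 - Qf (δ / σ) - E / δ * Qf (δ / σ))
        + 1 / β * (E + σ / Real.sqrt (2 * π)) : ℝ) : EReal) := by
  have hd : 0 < -δ := by
    have : 0 < σ / Real.sqrt (rexp 1) := by positivity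
    linarith
  have hδ0 : δ ≠ 0 := by linarith
  unfold capacityAvg
  refine iSup₂_le ?_
  rintro μ ⟨hμ, hpos, hmean⟩
  have h := main_bound hσ hE hβ hd μ hpos hmean
  refine h.trans ?_
  rw [EReal.coe_le_coe_iff]
  simp only [neg_neg, neg_sq]
  have hQ1 : Qf (δ / σ) ≤ 1 := by rw [Qf_eq]; exact measureReal_le_one
  have e : δ ^ 2 / (2 * σ ^ 2) * (1 - Qf (δ / σ) - E / δ * Qf (δ / σ)) =
      δ ^ 2 / (2 * σ ^ 2) * (1 - Qf (δ / σ)) + -δ * E / (2 * σ ^ 2) * Qf (δ / σ) := by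
    field_simp
    ring
  have e2 : -δ / σ ^ 2 * (E * Qf (δ / σ)) =
      -δ * E / (2 * σ ^ 2) * Qf (δ / σ) + -δ * E / (2 * σ ^ 2) * Qf (δ / σ) := by
    field_simp
    ring
  have h3 : -δ * E / (2 * σ ^ 2) * Qf (δ / σ) ≤ -δ * E / (2 * σ ^ 2) * 1 := by
    gcongr
  have e4 : -δ * E / (2 * σ ^ 2) = -(δ * E / (2 * σ ^ 2)) := by ring
  rw [e, e2]
  rw [e4] at h3 ⊢
  linarith
end

section
/- For every σ > 0, the high-power asymptotics of the average-power-constrained capacity is: lim_{E → ∞} ( C(E) − log(E/σ) ) = (1/2)·log( e/(2π) ). -/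
open MeasureTheory ProbabilityTheory Real Filter Set
open scoped Classical Topology

open scoped ENNReal NNReal

noncomputable def outDens (v : ℝ≥0) (Q : Measure ℝ) (y : ℝ) : ℝ≥0∞ := ∫⁻ x, gaussianPDF x v y ∂Q

lemma meas_pdf2 (v : ℝ≥0) : Measurable (fun p : ℝ × ℝ => gaussianPDF p.1 v p.2) :=
  measurable_uncurry_gaussianPDF.comp
    (measurable_fst.prodMk (measurable_const.prodMk measurable_snd))

lemma meas_pdf2' (v : ℝ≥0) : Measurable (fun p : ℝ × ℝ => gaussianPDFReal p.1 v p.2) :=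
  measurable_uncurry_gaussianPDFReal.comp
    (measurable_fst.prodMk (measurable_const.prodMk measurable_snd))

lemma meas_pdf1 (v : ℝ≥0) (y : ℝ) : Measurable (fun x => gaussianPDF x v y) := by
  have h1 : Measurable (fun x : ℝ => (x, y)) := measurable_id.prodMk measurable_const
  have h := (meas_pdf2 v).comp h1
  simp only [Function.comp_def] at h
  exact h

lemma meas_outDens (v : ℝ≥0) (Q : Measure ℝ) [SFinite Q] : Measurable (outDens v Q) :=
  Measurable.lintegral_prod_left' (meas_pdf2 v)

lemma pdf_le (x : ℝ) (v : ℝ≥0) (y : ℝ) : gaussianPDFReal x v y ≤ (√(2 * π * v))⁻¹ := by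
  rw [gaussianPDFReal_def]
  apply mul_le_of_le_one_right (by positivity)
  rw [Real.exp_le_one_iff]
  have : 0 ≤ (y - x) ^ 2 / (2 * (v : ℝ)) := by positivity
  have h2 : -(y - x) ^ 2 / (2 * (v : ℝ)) = - ((y - x) ^ 2 / (2 * (v : ℝ))) := by ring
  linarith

lemma outDens_le (v : ℝ≥0) (Q : Measure ℝ) [IsProbabilityMeasure Q] (y : ℝ) :
    outDens v Q y ≤ ENNReal.ofReal (√(2 * π * v))⁻¹ := by
  unfold outDens
  calc _ ≤ ∫⁻ x, ENNReal.ofReal (√(2 * π * v))⁻¹ ∂Q :=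
        lintegral_mono fun x => ENNReal.ofReal_le_ofReal (pdf_le x v y)
    _ = _ := by simp

lemma outDens_ne_top (v : ℝ≥0) (Q : Measure ℝ) [IsProbabilityMeasure Q] (y : ℝ) :
    outDens v Q y ≠ ⊤ := ne_top_of_le_ne_top ENNReal.ofReal_ne_top (outDens_le v Q y)

lemma outDens_ne_zero {v : ℝ≥0} (hv : v ≠ 0) (Q : Measure ℝ) [IsProbabilityMeasure Q] (y : ℝ) :
    outDens v Q y ≠ 0 := by
  unfold outDens
  have hm : Measurable (fun x => gaussianPDF x v y) :=
    meas_pdf1 v y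
  rw [Ne, lintegral_eq_zero_iff hm]
  intro h
  have : ∀ᵐ x ∂Q, False := by
    filter_upwards [h] with x hx
    exact (gaussianPDF_pos x hv y).ne' hx
  simp at this
  exact IsProbabilityMeasure.ne_zero Q this

lemma joint_eq_s14 (v : ℝ≥0) (hv : v ≠ 0) (Q : Measure ℝ) [IsProbabilityMeasure Q] :
    (Q.prod (gaussianReal 0 v)).map (fun p => (p.1, p.1 + p.2)) =
      (Q.prod volume).withDensity (fun p => gaussianPDF p.1 v p.2) := by
  ext s hs
  have hm : Measurable (fun p : ℝ × ℝ => (p.1, p.1 + p.2)) := by fun_prop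
  rw [Measure.map_apply hm hs, Measure.prod_apply (hm hs), withDensity_apply _ hs,
    ← lintegral_indicator hs, lintegral_prod _ ((meas_pdf2 v).indicator hs).aemeasurable]
  congr 1
  ext x
  have h1 : gaussianReal x v = (gaussianReal 0 v).map (fun z => x + z) := by
    rw [gaussianReal_map_const_add, zero_add]
  have hs' : MeasurableSet (Prod.mk x ⁻¹' s) := measurable_prodMk_left hs
  have h2 : gaussianReal x v (Prod.mk x ⁻¹' s) = ∫⁻ y in (Prod.mk x ⁻¹' s), gaussianPDF x v y :=
    gaussianReal_apply x hv _
  rw [h1, Measure.map_apply (by fun_prop) hs', ← lintegral_indicator hs'] at h2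
  exact h2

lemma snd_eq (v : ℝ≥0) (Q : Measure ℝ) [IsProbabilityMeasure Q] :
    ((Q.prod volume).withDensity (fun p => gaussianPDF p.1 v p.2)).map Prod.snd =
      volume.withDensity (outDens v Q) := by
  ext s hs
  have hs' : MeasurableSet (Prod.snd ⁻¹' s : Set (ℝ × ℝ)) := measurable_snd hs
  rw [Measure.map_apply measurable_snd hs, withDensity_apply _ hs', withDensity_apply _ hs,
    ← lintegral_indicator hs', lintegral_prod_symm _ ((meas_pdf2 v).indicator hs').aemeasurable,
    ← lintegral_indicator hs]
  congr 1
  ext y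
  by_cases hy : y ∈ s <;> simp [Set.indicator, hy, outDens]

/-- output law -/
noncomputable def outLaw (v : ℝ≥0) (Q : Measure ℝ) : Measure ℝ := volume.withDensity (outDens v Q)


lemma klDiv_joint (v : ℝ≥0) (hv : v ≠ 0) (Q : Measure ℝ) [IsProbabilityMeasure Q]
    (P : Measure (ℝ × ℝ)) (hP : P = (Q.prod (gaussianReal 0 v)).map (fun p => (p.1, p.1 + p.2))) :
    P ≪ (P.map Prod.fst).prod (P.map Prod.snd) ∧
    P.map Prod.snd = outLaw v Q ∧
    llr P ((P.map Prod.fst).prod (P.map Prod.snd)) =ᵐ[P]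
      fun p => Real.log (gaussianPDFReal p.1 v p.2) - Real.log (outDens v Q p.2).toReal := by
  have hm : Measurable (fun p : ℝ × ℝ => (p.1, p.1 + p.2)) := by fun_prop
  have hfst : P.map Prod.fst = Q := by
    rw [hP, Measure.map_map measurable_fst hm]
    have : (Prod.fst ∘ fun p : ℝ × ℝ => (p.1, p.1 + p.2)) = Prod.fst := rfl
    rw [this, Measure.map_fst_prod]; simp
  have hP2 := hP.trans (joint_eq_s14 v hv Q)
  have hsnd : P.map Prod.snd = outLaw v Q := by rw [hP2, snd_eq]; rfl
  have hmo := meas_outDens v Q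
  have hR : (P.map Prod.fst).prod (P.map Prod.snd) =
      (Q.prod volume).withDensity (fun p => outDens v Q p.2) := by
    rw [hfst, hsnd, outLaw, prod_withDensity_right hmo]
  have hprob : IsProbabilityMeasure P := by
    rw [hP]; exact Measure.isProbabilityMeasure_map hm.aemeasurable
  have : IsProbabilityMeasure (P.map Prod.fst) :=
    Measure.isProbabilityMeasure_map measurable_fst.aemeasurable
  have : IsProbabilityMeasure (P.map Prod.snd) :=
    Measure.isProbabilityMeasure_map measurable_snd.aemeasurable
  set R := (P.map Prod.fst).prod (P.map Prod.snd) with hRdef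
  have hmd : Measurable (fun p : ℝ × ℝ => gaussianPDF p.1 v p.2 / outDens v Q p.2) :=
    (meas_pdf2 v).div (hmo.comp measurable_snd)
  have hPR : P = R.withDensity (fun p => gaussianPDF p.1 v p.2 / outDens v Q p.2) := by
    have hmo2 : Measurable (fun p : ℝ × ℝ => outDens v Q p.2) := hmo.comp measurable_snd
    rw [hR, ← withDensity_mul _ hmo2 hmd, hP2]
    congr 1
    ext p
    simp only [Pi.mul_apply]
    rw [ENNReal.mul_div_cancel (outDens_ne_zero hv Q _) (outDens_ne_top v Q _)]
  have hac : P ≪ R := by rw [hPR]; exact withDensity_absolutelyContinuous _ _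
  refine ⟨hac, hsnd, ?_⟩
  have hrn : P.rnDeriv R =ᵐ[R] fun p => gaussianPDF p.1 v p.2 / outDens v Q p.2 := by
    conv_lhs => rw [hPR]
    exact Measure.rnDeriv_withDensity _ hmd
  filter_upwards [hac.ae_le hrn] with p hp
  rw [llr, hp, ENNReal.toReal_div, toReal_gaussianPDF, Real.log_div]
  · exact (gaussianPDFReal_pos _ _ _ hv).ne'
  · exact (ENNReal.toReal_pos (outDens_ne_zero hv Q _) (outDens_ne_top v Q _)).ne'

lemma log_pdf (v : ℝ≥0) (hv : v ≠ 0) (x y : ℝ) : Real.log (gaussianPDFReal x v y) =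
    -(1/2) * Real.log (2 * π * v) - (y - x)^2 / (2 * v) := by
  have : (0:ℝ) < v := by positivity
  rw [gaussianPDFReal_def, Real.log_mul (by positivity) (by positivity), Real.log_exp, Real.log_inv,
    Real.log_sqrt (by positivity)]
  ring

lemma int_sq_gauss (v : ℝ≥0) : Integrable (fun z : ℝ => z^2) (gaussianReal 0 v) :=
  (memLp_id_gaussianReal (μ := 0) (v := v) 2).integrable_sq

lemma integral_sq_gauss (v : ℝ≥0) : ∫ z, z^2 ∂(gaussianReal 0 v) = v := by
  have h := variance_fun_id_gaussianReal (μ := 0) (v := v)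
  rw [variance_eq_integral (by fun_prop)] at h
  simpa [integral_id_gaussianReal] using h

lemma int_abs_gauss (v : ℝ≥0) : Integrable (fun z : ℝ => |z|) (gaussianReal 0 v) :=
  ((memLp_id_gaussianReal (μ := 0) (v := v) 1).integrable (by simp)).abs

lemma int_id_gauss (v : ℝ≥0) : Integrable (fun z : ℝ => z) (gaussianReal 0 v) :=
  ((memLp_id_gaussianReal (μ := 0) (v := v) 1).integrable (by simp))

/-- transfer of integrability from joint to output -/
lemma out_map (v : ℝ≥0) (hv : v ≠ 0) (Q : Measure ℝ) [IsProbabilityMeasure Q] :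
    outLaw v Q = (Q.prod (gaussianReal 0 v)).map (fun p => p.1 + p.2) := by
  rw [outLaw, ← snd_eq, ← joint_eq_s14 v hv, Measure.map_map measurable_snd (by fun_prop)]
  rfl

lemma kl_formula (v : ℝ≥0) (hv : v ≠ 0) (Q : Measure ℝ) [IsProbabilityMeasure Q]
    (P : Measure (ℝ × ℝ)) (hP : P = (Q.prod (gaussianReal 0 v)).map (fun p => (p.1, p.1 + p.2)))
    (hint : Integrable (fun y => Real.log (outDens v Q y).toReal) (outLaw v Q)) :
    klDiv P ((P.map Prod.fst).prod (P.map Prod.snd)) =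
     ((-(1/2) * Real.log (2 * π * v) - 1/2 -
      ∫ y, Real.log (outDens v Q y).toReal ∂(outLaw v Q) : ℝ) : EReal) := by
  obtain ⟨h1, h2, h3⟩ := klDiv_joint v hv Q P hP
  have hm : Measurable (fun p : ℝ × ℝ => (p.1, p.1 + p.2)) := by fun_prop
  have hv' : (v : ℝ) ≠ 0 := by exact_mod_cast hv
  have i2 : Integrable (fun p : ℝ × ℝ => Real.log (outDens v Q p.2).toReal) P := by
    rw [← h2] at hint
    exact hint.comp_measurable measurable_snd
  have e2 : ∫ p, Real.log (outDens v Q p.2).toReal ∂P =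
      ∫ y, Real.log (outDens v Q y).toReal ∂(outLaw v Q) := by
    rw [← h2] at hint ⊢
    rw [integral_map measurable_snd.aemeasurable hint.1]
  have hg : Integrable (fun z : ℝ => -(1/2) * Real.log (2 * π * v) - z^2 / (2 * v))
      (gaussianReal 0 v) := (integrable_const _).sub ((int_sq_gauss v).div_const _)
  have hl : AEStronglyMeasurable (fun p : ℝ × ℝ => Real.log (gaussianPDFReal p.1 v p.2)) P :=
    (Real.measurable_log.comp (meas_pdf2' v)).aestronglyMeasurable
  have key : ((fun p : ℝ × ℝ => Real.log (gaussianPDFReal p.1 v p.2)) ∘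
      fun p : ℝ × ℝ => (p.1, p.1 + p.2)) =
      fun p => -(1/2) * Real.log (2 * π * v) - p.2^2 / (2 * v) := by
    ext p; simp [log_pdf v hv]
  have i1 : Integrable (fun p : ℝ × ℝ => Real.log (gaussianPDFReal p.1 v p.2)) P := by
    rw [hP] at hl ⊢
    rw [integrable_map_measure hl hm.aemeasurable, key]
    exact hg.comp_snd Q
  have e1 : ∫ p, Real.log (gaussianPDFReal p.1 v p.2) ∂P =
      -(1/2) * Real.log (2 * π * v) - 1/2 := by
    rw [hP] at hl ⊢
    rw [integral_map hm.aemeasurable hl]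
    have : (fun p : ℝ × ℝ => Real.log (gaussianPDFReal (p.1, p.1 + p.2).1 v (p.1, p.1 + p.2).2)) =
      fun p => -(1/2) * Real.log (2 * π * v) - p.2^2 / (2 * v) := key
    rw [this, integral_fun_snd (fun z : ℝ => -(1/2) * Real.log (2 * π * v) - z^2 / (2 * v)),
      integral_sub (integrable_const _) ((int_sq_gauss v).div_const _), integral_div,
      integral_sq_gauss]
    simp
    field_simp
  rw [klDiv, if_pos ⟨h1, (integrable_congr h3).2 (i1.sub i2)⟩, integral_congr_ae h3,
    integral_sub i1 i2, e1, e2]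

noncomputable def refDens (a c y : ℝ) : ℝ := (a + c)⁻¹ * rexp (-(max y 0) / a - (max (-y) 0) / c)

lemma refDens_pos {a c : ℝ} (ha : 0 < a) (hc : 0 < c) (y : ℝ) : 0 < refDens a c y := by
  unfold refDens; positivity

lemma meas_refDens (a c : ℝ) : Measurable (refDens a c) := by
  unfold refDens; fun_prop

lemma log_refDens {a c : ℝ} (ha : 0 < a) (hc : 0 < c) (y : ℝ) :
    Real.log (refDens a c y) = - Real.log (a + c) - (max y 0) / a - (max (-y) 0) / c := by
  unfold refDens
  rw [Real.log_mul (by positivity) (by positivity), Real.log_inv, Real.log_exp]; ring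

lemma refDens_int {a c : ℝ} (ha : 0 < a) (hc : 0 < c) :
    Integrable (refDens a c) ∧ ∫ y, refDens a c y = 1 := by
  have e1 : EqOn (refDens a c) (fun y => (a + c)⁻¹ * rexp (c⁻¹ * y)) (Iic 0) := by
    intro y hy
    have hy : y ≤ 0 := hy
    simp only [refDens]
    rw [max_eq_right hy, max_eq_left (by linarith)]
    congr 2; field_simp; ring
  have e2 : EqOn (refDens a c) (fun y => (a + c)⁻¹ * rexp (-a⁻¹ * y)) (Ioi 0) := by
    intro y hy
    have hy : 0 < y := hy
    simp only [refDens]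
    rw [max_eq_left hy.le, max_eq_right (by linarith)]
    congr 2; field_simp; ring
  have hc' : 0 < c⁻¹ := by positivity
  have ha' : -a⁻¹ < 0 := by simpa using ha
  have i1 : IntegrableOn (refDens a c) (Iic 0) :=
    (IntegrableOn.congr_fun ((integrableOn_exp_mul_Iic hc' 0).const_mul (a + c)⁻¹) e1.symm
      measurableSet_Iic)
  have i2 : IntegrableOn (refDens a c) (Ioi 0) :=
    (IntegrableOn.congr_fun ((integrableOn_exp_mul_Ioi ha' 0).const_mul (a + c)⁻¹) e2.symm
      measurableSet_Ioi)
  refine ⟨?_, ?_⟩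
  · rw [← integrableOn_univ, ← Iic_union_Ioi (a := (0:ℝ))]
    exact i1.union i2
  · rw [← intervalIntegral.integral_Iic_add_Ioi i1 i2, setIntegral_congr_fun measurableSet_Iic e1,
      setIntegral_congr_fun measurableSet_Ioi e2, integral_const_mul, integral_const_mul,
      integral_exp_mul_Iic hc', integral_exp_mul_Ioi ha']
    simp
    field_simp
    ring

lemma gibbs (v : ℝ≥0) (hv : v ≠ 0) (Q : Measure ℝ) [IsProbabilityMeasure Q] {a c : ℝ}
    (ha : 0 < a) (hc : 0 < c)
    (hi : Integrable (fun y => Real.log (refDens a c y)) (outLaw v Q)) :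
    Integrable (fun y => Real.log (outDens v Q y).toReal) (outLaw v Q) ∧
    ∫ y, Real.log (refDens a c y) ∂(outLaw v Q) ≤
      ∫ y, Real.log (outDens v Q y).toReal ∂(outLaw v Q) := by
  have hmo := meas_outDens v Q
  have hprob : IsProbabilityMeasure (outLaw v Q) := by
    rw [out_map v hv]
    exact Measure.isProbabilityMeasure_map (by fun_prop)
  have hpos : ∀ y, 0 < (outDens v Q y).toReal := fun y =>
    ENNReal.toReal_pos (outDens_ne_zero hv Q _) (outDens_ne_top v Q _)
  have hfin : ∀ᵐ y ∂(volume : Measure ℝ), outDens v Q y < ⊤ :=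
    Eventually.of_forall fun y => (outDens_ne_top v Q y).lt_top
  obtain ⟨ri, r1⟩ := refDens_int ha hc
  have key : (fun y => (outDens v Q y).toReal • (refDens a c y / (outDens v Q y).toReal)) =
      refDens a c := by
    ext y
    have := (hpos y).ne'
    simp only [smul_eq_mul]; field_simp
  have qi : Integrable (fun y => refDens a c y / (outDens v Q y).toReal) (outLaw v Q) := by
    rw [outLaw, integrable_withDensity_iff_integrable_smul' hmo hfin, key]
    exact ri
  have q1 : ∫ y, refDens a c y / (outDens v Q y).toReal ∂(outLaw v Q) = 1 := by
    rw [outLaw, integral_withDensity_eq_integral_toReal_smul hmo hfin, key, r1]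
  have lower : ∀ y, Real.log (refDens a c y) - refDens a c y / (outDens v Q y).toReal + 1 ≤
      Real.log (outDens v Q y).toReal := by
    intro y
    have h := Real.log_le_sub_one_of_pos (div_pos (refDens_pos ha hc y) (hpos y))
    rw [Real.log_div (refDens_pos ha hc y).ne' (hpos y).ne'] at h
    linarith
  have upper : ∀ y, Real.log (outDens v Q y).toReal ≤ Real.log (√(2 * π * v))⁻¹ := by
    intro y
    apply Real.log_le_log (hpos y)
    exact ENNReal.toReal_le_of_le_ofReal (by positivity) (outDens_le v Q y)
  have li : Integrable (fun y => Real.log (refDens a c y) -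
      refDens a c y / (outDens v Q y).toReal + 1) (outLaw v Q) :=
    (hi.sub qi).add (integrable_const _)
  have fi : Integrable (fun y => Real.log (outDens v Q y).toReal) (outLaw v Q) := by
    refine Integrable.mono' (li.abs.add (integrable_const |Real.log (√(2 * π * v))⁻¹|))
      (Real.measurable_log.comp hmo.ennreal_toReal).aestronglyMeasurable
      (Eventually.of_forall fun y => ?_)
    rw [Real.norm_eq_abs, abs_le]
    have h1 := lower y
    have h2 := upper y
    simp only [Pi.add_apply]
    constructor
    · have := neg_abs_le (Real.log (refDens a c y) - refDens a c y / (outDens v Q y).toReal + 1)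
      have := abs_nonneg (Real.log (√(2 * π * v))⁻¹)
      linarith
    · have := abs_nonneg (Real.log (refDens a c y) - refDens a c y / (outDens v Q y).toReal + 1)
      have := le_abs_self (Real.log (√(2 * π * v))⁻¹)
      linarith
  refine ⟨fi, ?_⟩
  have := integral_mono li fi lower
  have hq : Integrable (fun y => Real.log (refDens a c y) -
      refDens a c y / (outDens v Q y).toReal) (outLaw v Q) := hi.sub qi
  rw [integral_add hq (integrable_const _), integral_sub hi qi, q1] at this
  simpa using this

lemma input_facts (Q : Measure ℝ) [IsProbabilityMeasure Q] {E : ℝ} (hE : 0 < E)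
    (h0 : Q (Set.Ici 0) = 1) (h1 : ∫⁻ x, ENNReal.ofReal x ∂Q ≤ ENNReal.ofReal E) :
    (∀ᵐ x ∂Q, 0 ≤ x) ∧ Integrable (fun x => x) Q ∧ ∫ x, x ∂Q ≤ E := by
  have hn : ∀ᵐ x ∂Q, 0 ≤ x := by
    have := (prob_compl_eq_zero_iff (μ := Q) measurableSet_Ici).2 h0
    exact this
  refine ⟨hn, ?_, ?_⟩
  · refine ⟨by fun_prop, ?_⟩
    rw [hasFiniteIntegral_iff_ofReal hn]
    exact h1.trans_lt ENNReal.ofReal_lt_top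
  · rw [integral_eq_lintegral_of_nonneg_ae hn (by fun_prop)]
    exact ENNReal.toReal_le_of_le_ofReal hE.le h1

lemma ref_bound (v : ℝ≥0) (hv : v ≠ 0) (Q : Measure ℝ) [IsProbabilityMeasure Q] {E a c : ℝ}
    (ha : 0 < a) (hc : 0 < c) (hn : ∀ᵐ x ∂Q, 0 ≤ x) (hi : Integrable (fun x => x) Q)
    (hE : ∫ x, x ∂Q ≤ E) :
    Integrable (fun y => Real.log (refDens a c y)) (outLaw v Q) ∧
    - Real.log (a + c) - (E + ∫ z, |z| ∂(gaussianReal 0 v)) / a - (∫ z, |z| ∂(gaussianReal 0 v)) / c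
      ≤ ∫ y, Real.log (refDens a c y) ∂(outLaw v Q) := by
  have hm : Measurable (fun p : ℝ × ℝ => p.1 + p.2) := by fun_prop
  have ix : Integrable (fun p : ℝ × ℝ => p.1) (Q.prod (gaussianReal 0 v)) := hi.comp_fst _
  have iz : Integrable (fun p : ℝ × ℝ => |p.2|) (Q.prod (gaussianReal 0 v)) :=
    (int_abs_gauss v).comp_snd Q
  have hl : Measurable (fun y => Real.log (refDens a c y)) :=
    Real.measurable_log.comp (meas_refDens a c)
  have hn' : ∀ᵐ p ∂(Q.prod (gaussianReal 0 v)), 0 ≤ p.1 :=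
    Measure.quasiMeasurePreserving_fst.ae hn
  have lb : ∀ᵐ p ∂(Q.prod (gaussianReal 0 v)),
      - Real.log (a + c) - (p.1 + |p.2|) / a - |p.2| / c ≤ Real.log (refDens a c (p.1 + p.2)) := by
    filter_upwards [hn'] with p hp
    rw [log_refDens ha hc]
    have h1 : max (p.1 + p.2) 0 ≤ p.1 + |p.2| :=
      max_le (by linarith [le_abs_self p.2]) (by linarith [abs_nonneg p.2])
    have h2 : max (-(p.1 + p.2)) 0 ≤ |p.2| :=
      max_le (by linarith [neg_abs_le p.2]) (abs_nonneg p.2)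
    gcongr
  have ub : ∀ p : ℝ × ℝ, Real.log (refDens a c (p.1 + p.2)) ≤ - Real.log (a + c) := by
    intro p
    rw [log_refDens ha hc]
    have h1 : 0 ≤ max (p.1 + p.2) 0 / a := div_nonneg (le_max_right _ _) ha.le
    have h2 : 0 ≤ max (-(p.1 + p.2)) 0 / c := div_nonneg (le_max_right _ _) hc.le
    linarith
  have li : Integrable (fun p : ℝ × ℝ => - Real.log (a + c) - (p.1 + |p.2|) / a - |p.2| / c)
      (Q.prod (gaussianReal 0 v)) :=
    ((integrable_const _).sub ((ix.add iz).div_const a)).sub (iz.div_const c)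
  have fi : Integrable (fun p : ℝ × ℝ => Real.log (refDens a c (p.1 + p.2)))
      (Q.prod (gaussianReal 0 v)) := by
    refine Integrable.mono' (li.abs.add (integrable_const |- Real.log (a + c)|))
      (hl.comp hm).aestronglyMeasurable ?_
    filter_upwards [lb] with p hp
    have h2 := ub p
    rw [Real.norm_eq_abs, abs_le]
    simp only [Pi.add_apply]
    constructor
    · have := neg_abs_le (- Real.log (a + c) - (p.1 + |p.2|) / a - |p.2| / c)
      have := abs_nonneg (- Real.log (a + c))
      linarith
    · have := abs_nonneg (- Real.log (a + c) - (p.1 + |p.2|) / a - |p.2| / c)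
      have := le_abs_self (- Real.log (a + c))
      linarith
  rw [out_map v hv, integrable_map_measure hl.aestronglyMeasurable hm.aemeasurable,
    integral_map hm.aemeasurable hl.aestronglyMeasurable]
  refine ⟨fi, ?_⟩
  have h := integral_mono_ae li fi lb
  have ixz : Integrable (fun p : ℝ × ℝ => (p.1 + |p.2|) / a) (Q.prod (gaussianReal 0 v)) :=
    (ix.add iz).div_const a
  have ixz2 : Integrable (fun p : ℝ × ℝ => - Real.log (a + c) - (p.1 + |p.2|) / a)
    (Q.prod (gaussianReal 0 v)) := (integrable_const _).sub ixz
  rw [integral_sub ixz2 (iz.div_const c), integral_sub (integrable_const _) ixz, integral_div, integral_div,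
    integral_add ix iz, integral_fun_fst (fun x : ℝ => x), integral_fun_snd (fun z : ℝ => |z|)] at h
  simp only [integral_const, probReal_univ, one_smul] at h
  refine le_trans ?_ h
  gcongr

noncomputable def KK (v : ℝ≥0) : ℝ := ∫ z, |z| ∂(gaussianReal 0 v)

noncomputable def vOf (σ : ℝ) : ℝ≥0 := ⟨σ ^ 2, sq_nonneg σ⟩

lemma vOf_facts (σ : ℝ) (hσ : 0 < σ) : ((vOf σ : ℝ≥0) : ℝ) = σ ^ 2 ∧ vOf σ ≠ 0 ∧
    ∀ Q : Measure ℝ, jointLaw σ Q =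
      (Q.prod (gaussianReal 0 (vOf σ))).map (fun p => (p.1, p.1 + p.2)) := by
  have h : ((vOf σ : ℝ≥0) : ℝ) = σ ^ 2 := rfl
  refine ⟨h, ?_, fun Q => rfl⟩
  intro h0
  rw [h0] at h
  have : 0 < σ ^ 2 := by positivity
  simp at h
  linarith

lemma upper_bound (σ : ℝ) (hσ : 0 < σ) {E : ℝ} (hE : 0 < E) :
    capacityAvg σ E ≤ ((-(1/2) * Real.log (2 * π * σ^2) - 1/2 + Real.log (E + √E) +
      (E + KK (vOf σ)) / E + KK (vOf σ) / √E : ℝ) : EReal) := by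
  obtain ⟨hvc, hv, hj⟩ := vOf_facts σ hσ
  refine iSup₂_le ?_
  rintro Q ⟨hQ, h0, h1⟩
  obtain ⟨a1, a2, a3⟩ := input_facts Q hE h0 h1
  obtain ⟨b1, b2⟩ := ref_bound _ hv Q hE (Real.sqrt_pos.2 hE) a1 a2 a3
  obtain ⟨c1, c2⟩ := gibbs _ hv Q hE (Real.sqrt_pos.2 hE) b1
  rw [mutualInfo, kl_formula _ hv Q (jointLaw σ Q) (hj Q) c1]
  rw [EReal.coe_le_coe_iff]
  have := b2.trans c2
  simp only [KK]
  rw [hvc]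
  linarith

lemma expMeasure_facts {r : ℝ} (hr : 0 < r) :
    expMeasure r (Set.Ici 0) = 1 ∧ ∫⁻ x, ENNReal.ofReal x ∂(expMeasure r) = ENNReal.ofReal (1/r) := by
  have := isProbabilityMeasure_expMeasure hr
  have hd : expMeasure r = volume.withDensity (exponentialPDF r) := rfl
  have hm : Measurable (exponentialPDF r) := (measurable_exponentialPDFReal r).ennreal_ofReal
  constructor
  · rw [← prob_compl_eq_zero_iff measurableSet_Ici, hd, withDensity_apply _ measurableSet_Ici.compl,
      compl_Ici]
    exact lintegral_exponentialPDF_of_nonpos le_rfl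
  · rw [hd, lintegral_withDensity_eq_lintegral_mul _ hm (by fun_prop)]
    have : (exponentialPDF r * fun x => ENNReal.ofReal x) =
        fun x => ENNReal.ofReal (1/r) * gammaPDF 2 r x := by
      ext x
      simp only [Pi.mul_apply]
      rw [exponentialPDF_eq, gammaPDF, gammaPDFReal]
      split_ifs with h
      · rw [← ENNReal.ofReal_mul (by positivity), ← ENNReal.ofReal_mul (by positivity)]
        congr 1
        have : (2:ℝ) - 1 = 1 := by norm_num
        rw [this, Real.rpow_one, Real.Gamma_two]
        norm_num
        field_simp
      · simp
    have hmg : Measurable (gammaPDF 2 r) := (measurable_gammaPDFReal 2 r).ennreal_ofReal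
    rw [this, lintegral_const_mul _ hmg,
      lintegral_gammaPDF_eq_one two_pos hr, mul_one]

lemma outDens_exp_le {v : ℝ≥0} (hv : v ≠ 0) {r : ℝ} (hr : 0 < r) (y : ℝ) :
    (outDens v (expMeasure r) y).toReal ≤ r * rexp (y * (-r) + v * (-r)^2 / 2) := by
  apply ENNReal.toReal_le_of_le_ofReal (by positivity)
  have hd : expMeasure r = volume.withDensity (exponentialPDF r) := rfl
  have hm : Measurable (exponentialPDF r) := (measurable_exponentialPDFReal r).ennreal_ofReal
  have hm2 : Measurable (fun x => gaussianPDF x v y) :=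
    meas_pdf1 v y
  rw [outDens, hd, lintegral_withDensity_eq_lintegral_mul _ hm hm2]
  have h := congrFun (mgf_fun_id_gaussianReal (μ := y) (v := v)) (-r)
  have hi := integrable_exp_mul_gaussianReal (μ := y) (v := v) (-r)
  rw [mgf] at h
  rw [← h, ← integral_const_mul, ofReal_integral_eq_lintegral_ofReal (hi.const_mul r)
    (Eventually.of_forall fun x => by positivity), gaussianReal_of_var_ne_zero _ hv,
    lintegral_withDensity_eq_lintegral_mul _ (measurable_gaussianPDF y v) (by fun_prop)]
  apply lintegral_mono
  intro x
  simp only [Pi.mul_apply]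
  rw [mul_comm]
  have hs : gaussianPDF x v y = gaussianPDF y v x := by
    simp only [gaussianPDF, gaussianPDFReal_def]
    congr 4; ring
  rw [hs, exponentialPDF_eq]
  gcongr
  split_ifs
  · apply le_of_eq; congr 2; ring
  · positivity

lemma lower_bound (σ : ℝ) (hσ : 0 < σ) {E : ℝ} (hE : 0 < E) :
    ((-(1/2) * Real.log (2 * π * σ^2) - 1/2 + Real.log E + 1 - σ^2 / (2 * E^2) : ℝ) : EReal)
     ≤ capacityAvg σ E := by
  obtain ⟨hvc, hv, hj⟩ := vOf_facts σ hσ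
  have hr : 0 < 1 / E := by positivity
  have hQ := isProbabilityMeasure_expMeasure hr
  obtain ⟨h0, h1⟩ := expMeasure_facts hr
  rw [one_div_one_div] at h1
  have hmean : ∫ x, x ∂(expMeasure (1/E)) = E := by
    obtain ⟨a1, a2, a3⟩ := input_facts _ hE h0 h1.le
    rw [integral_eq_lintegral_of_nonneg_ae a1 (by fun_prop), h1, ENNReal.toReal_ofReal hE.le]
  refine le_trans ?_ (le_iSup₂_of_le (expMeasure (1/E)) ⟨hQ, h0, h1.le⟩ le_rfl)
  obtain ⟨a1, a2, a3⟩ := input_facts _ hE h0 h1.le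
  generalize vOf σ = v at hv hvc hj
  obtain ⟨b1, b2⟩ := ref_bound _ hv _ hE (Real.sqrt_pos.2 hE) a1 a2 a3
  obtain ⟨c1, c2⟩ := gibbs _ hv _ hE (Real.sqrt_pos.2 hE) b1
  rw [mutualInfo, kl_formula v hv _ (jointLaw σ _) (hj _) c1]
  rw [EReal.coe_le_coe_iff, hvc]
  have hm : Measurable (fun p : ℝ × ℝ => p.1 + p.2) := by fun_prop
  have ix : Integrable (fun p : ℝ × ℝ => p.1) ((expMeasure (1/E)).prod (gaussianReal 0 v)) :=
    a2.comp_fst _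
  have iz : Integrable (fun p : ℝ × ℝ => p.2) ((expMeasure (1/E)).prod (gaussianReal 0 v)) :=
    (int_id_gauss v).comp_snd _
  have iy : Integrable (fun y => y) (outLaw v (expMeasure (1/E))) := by
    rw [out_map v hv, integrable_map_measure (by fun_prop) hm.aemeasurable]
    exact ix.add iz
  have ey : ∫ y, y ∂(outLaw v (expMeasure (1/E))) = E := by
    rw [out_map v hv, integral_map hm.aemeasurable (by fun_prop), integral_add ix iz,
      integral_fun_fst (fun x : ℝ => x), integral_fun_snd (fun z : ℝ => z), hmean]
    simp
  have hprob : IsProbabilityMeasure (outLaw v (expMeasure (1/E))) := by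
    rw [out_map v hv]
    exact Measure.isProbabilityMeasure_map (by fun_prop)
  have hb : ∀ y, Real.log (outDens v (expMeasure (1/E)) y).toReal ≤
      (-Real.log E + σ^2 / (2 * E^2)) - y / E := by
    intro y
    have h := Real.log_le_log (ENNReal.toReal_pos (outDens_ne_zero hv _ y) (outDens_ne_top v _ y))
      (outDens_exp_le hv hr y)
    rw [Real.log_mul hr.ne' (Real.exp_ne_zero _), Real.log_exp, one_div, Real.log_inv, hvc] at h
    rw [one_div]
    refine h.trans (le_of_eq ?_)
    field_simp
    ring
  have h := integral_mono c1 ((integrable_const _).sub (iy.div_const E)) hb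
  simp only [Pi.sub_apply] at h
  rw [integral_sub (integrable_const _) (iy.div_const E), integral_div, ey, div_self hE.ne'] at h
  simp only [integral_const, probReal_univ, one_smul] at h
  linarith

lemma limU (K : ℝ) : Tendsto (fun E : ℝ => 1/2 + Real.log (1 + 1/√E) + K / E + K / √E)
    atTop (𝓝 (1/2)) := by
  have hs : Tendsto (fun E : ℝ => √E) atTop atTop := Real.tendsto_sqrt_atTop
  have h1 : Tendsto (fun E : ℝ => 1/√E) atTop (𝓝 0) := tendsto_const_nhds.div_atTop hs
  have h2 : Tendsto (fun E : ℝ => K/√E) atTop (𝓝 0) := tendsto_const_nhds.div_atTop hs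
  have h3 : Tendsto (fun E : ℝ => K/E) atTop (𝓝 0) := tendsto_const_nhds.div_atTop tendsto_id
  have h4 : Tendsto (fun E : ℝ => Real.log (1 + 1/√E)) atTop (𝓝 0) := by
    have : Tendsto (fun E : ℝ => 1 + 1/√E) atTop (𝓝 1) := by
      simpa using (tendsto_const_nhds (x := (1:ℝ))).add h1
    have := this.log one_ne_zero
    simpa using this
  simpa using (((tendsto_const_nhds (x := (1/2:ℝ))).add h4).add h3).add h2

lemma limL (s : ℝ) : Tendsto (fun E : ℝ => 1/2 - s / (2 * E^2)) atTop (𝓝 (1/2)) := by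
  have h : Tendsto (fun E : ℝ => 2 * E^2) atTop atTop :=
    (tendsto_pow_atTop two_ne_zero).const_mul_atTop two_pos
  have h3 : Tendsto (fun E : ℝ => s/(2 * E^2)) atTop (𝓝 0) := tendsto_const_nhds.div_atTop h
  simpa using (tendsto_const_nhds (x := (1/2:ℝ))).sub h3

/-- High-power asymptotics of the average-power-constrained capacity:
`C(E) − log(E/σ) → (1/2) log(e/(2π))` as `E → ∞`. -/
theorem capacityAvg_high_power_asymptotics (σ : ℝ) (hσ : 0 < σ) :
    Tendsto (fun E : ℝ => capacityAvg σ E - ((Real.log (E / σ) : ℝ) : EReal)) atTop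
      (𝓝 ((1 / 2 * Real.log (rexp 1 / (2 * π)) : ℝ) : EReal)) := by
  have hconst : 1 / 2 * Real.log (rexp 1 / (2 * π)) = 1/2 - 1/2 * Real.log (2 * π) := by
    rw [Real.log_div (by positivity) (by positivity), Real.log_exp]; ring
  have hls : Real.log (2 * π * σ^2) = Real.log (2 * π) + 2 * Real.log σ := by
    rw [Real.log_mul (by positivity) (by positivity), Real.log_pow]; norm_num
  rw [hconst]
  set K := KK (vOf σ) with hK
  refine tendsto_of_tendsto_of_tendsto_of_le_of_le'
    (continuous_coe_real_ereal.continuousAt.tendsto.comp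
      ((limL (σ^2)).sub_const (1/2 * Real.log (2 * π))))
    (continuous_coe_real_ereal.continuousAt.tendsto.comp
      ((limU K).sub_const (1/2 * Real.log (2 * π)))) ?_ ?_
  · filter_upwards [eventually_gt_atTop 0] with E hE
    refine le_trans (le_of_eq ?_) (EReal.sub_le_sub (lower_bound σ hσ hE) le_rfl)
    rw [← EReal.coe_sub, Function.comp, EReal.coe_eq_coe_iff, hls, Real.log_div hE.ne' hσ.ne']
    ring
  · filter_upwards [eventually_gt_atTop 0] with E hE
    refine le_trans (EReal.sub_le_sub (upper_bound σ hσ hE) le_rfl) (le_of_eq ?_)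
    rw [← EReal.coe_sub, Function.comp, EReal.coe_eq_coe_iff, hls, Real.log_div hE.ne' hσ.ne']
    have hsq : 0 < √E := Real.sqrt_pos.2 hE
    have : E + √E = E * (1 + 1/√E) := by
      have := Real.mul_self_sqrt hE.le
      field_simp
      nlinarith
    rw [this, Real.log_mul hE.ne' (by positivity), ← hK, add_div, div_self hE.ne']
    ring
end

section
/- For every σ > 0, the low-power asymptotics of the average-power-constrained capacity satisfies liminf_{E → 0⁺} C(E) / ( (E/σ)·√(log(σ/E)) ) ≥ 1/√2. -/
open MeasureTheory ProbabilityTheory Real Filter Set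
open scoped Classical Topology

lemma dv_bound {α : Type*} [MeasurableSpace α] (P ν : Measure α) [IsProbabilityMeasure P]
    [IsProbabilityMeasure ν] (hac : P ≪ ν) (hint : Integrable (llr P ν) P) (g : α → ℝ)
    (hg : Measurable g) (hgi : Integrable g P)
    (hR : ∫⁻ x, ENNReal.ofReal (exp (g x)) ∂ν ≤ 1) :
    ∫ x, g x ∂P ≤ ∫ x, llr P ν x ∂P := by
  have h1 : ∫⁻ x, ENNReal.ofReal (exp (g x - llr P ν x)) ∂P ≤ 1 := by
    calc ∫⁻ x, ENNReal.ofReal (exp (g x - llr P ν x)) ∂P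
        = ∫⁻ x, ν.rnDeriv P x * ENNReal.ofReal (exp (g x)) ∂P := by
          apply lintegral_congr_ae
          filter_upwards [exp_neg_llr hac, Measure.rnDeriv_lt_top ν P] with x hx hx'
          rw [sub_eq_add_neg, Real.exp_add, hx, mul_comm, ENNReal.ofReal_mul ENNReal.toReal_nonneg,
            ENNReal.ofReal_toReal hx'.ne]
      _ = ∫⁻ x, ENNReal.ofReal (exp (g x)) ∂(P.withDensity (ν.rnDeriv P)) := by
          rw [lintegral_withDensity_eq_lintegral_mul _ (Measure.measurable_rnDeriv _ _)
            (by fun_prop)]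
          rfl
      _ ≤ ∫⁻ x, ENNReal.ofReal (exp (g x)) ∂ν :=
          lintegral_mono' (Measure.withDensity_rnDeriv_le _ _) le_rfl
      _ ≤ 1 := hR
  have hm : Measurable (fun x => exp (g x - llr P ν x)) :=
    (hg.sub (measurable_llr P ν)).exp
  have hi : Integrable (fun x => exp (g x - llr P ν x)) P := by
    refine ⟨hm.aestronglyMeasurable, ?_⟩
    rw [hasFiniteIntegral_iff_ofReal (ae_of_all _ fun x => (exp_pos _).le)]
    exact h1.trans_lt ENNReal.one_lt_top
  have h2 : ∫ x, exp (g x - llr P ν x) ∂P ≤ 1 := by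
    rw [integral_eq_lintegral_of_nonneg_ae (ae_of_all _ fun x => (exp_pos _).le)
      hm.aestronglyMeasurable]
    exact ENNReal.toReal_le_of_le_ofReal zero_le_one (by simpa using h1)
  have h3 : ∫ x, (g x - llr P ν x) ∂P ≤ ∫ x, (exp (g x - llr P ν x) - 1) ∂P := by
    apply integral_mono (hgi.sub hint) (hi.sub (integrable_const _))
    intro x
    have := Real.add_one_le_exp (g x - llr P ν x)
    simp only [Pi.sub_apply]; linarith
  rw [integral_sub hgi hint, integral_sub hi (integrable_const _)] at h3
  simp at h3
  linarith

lemma gauss_shift (σ : ℝ) (hσ : 0 < σ) (v : NNReal) (hvσ : (v : ℝ) = σ ^ 2) (A : ℝ) (f : ℝ → ENNReal) (hf : Measurable f) :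
    ∫⁻ z, f (A + z) ∂(gaussianReal 0 v) =
    ∫⁻ z, ENNReal.ofReal (exp (A * z / σ ^ 2 - A ^ 2 / (2 * σ ^ 2))) * f z
      ∂(gaussianReal 0 v) := by
  have hv : v ≠ 0 := by
    intro h
    rw [h] at hvσ
    simp at hvσ
    exact (pow_pos hσ 2).ne hvσ
  rw [← lintegral_map (μ := gaussianReal 0 v) (f := f)
    (g := fun z => A + z) hf (by fun_prop), gaussianReal_map_const_add,
    gaussianReal_of_var_ne_zero _ hv, gaussianReal_of_var_ne_zero _ hv,
    lintegral_withDensity_eq_lintegral_mul _ (measurable_gaussianPDF _ _) hf,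
    lintegral_withDensity_eq_lintegral_mul _ (measurable_gaussianPDF _ _) (by fun_prop)]
  congr 1 with z
  simp only [Pi.mul_apply, gaussianPDF]
  rw [← mul_assoc, ← ENNReal.ofReal_mul (gaussianPDFReal_nonneg _ _ _)]
  congr 2
  simp only [gaussianPDFReal_def, hvσ]
  rw [mul_assoc (√_)⁻¹, ← Real.exp_add]
  congr 2
  field_simp
  ring

noncomputable def onoff (p A : ℝ) : Measure ℝ :=
  ENNReal.ofReal (1 - p) • Measure.dirac 0 + ENNReal.ofReal p • Measure.dirac A

lemma onoff_prob (p A : ℝ) (hp : 0 ≤ p) (hp1 : p ≤ 1) : IsProbabilityMeasure (onoff p A) := by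
  constructor
  simp only [onoff, Measure.coe_add, Measure.coe_smul, Pi.add_apply, Pi.smul_apply, measure_univ,
    smul_eq_mul, mul_one]
  rw [← ENNReal.ofReal_add (by linarith) hp]
  simp

lemma lintegral_onoff (p A : ℝ) (f : ℝ → ENNReal) :
    ∫⁻ x, f x ∂(onoff p A) = ENNReal.ofReal (1 - p) * f 0 + ENNReal.ofReal p * f A := by
  simp [onoff, lintegral_add_measure, lintegral_smul_measure, lintegral_dirac]

lemma integral_onoff (p A : ℝ) (hp : 0 ≤ p) (hp1 : p ≤ 1) (f : ℝ → ℝ) :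
    ∫ x, f x ∂(onoff p A) = (1 - p) * f 0 + p * f A := by
  have h (a : ℝ) : Integrable f (Measure.dirac a) := integrable_dirac (by simp)
  rw [onoff, integral_add_measure ((h 0).smul_measure (by simp)) ((h A).smul_measure (by simp)),
    integral_smul_measure, integral_smul_measure]
  simp [ENNReal.toReal_ofReal hp, ENNReal.toReal_ofReal (sub_nonneg.2 hp1)]

noncomputable def tst (σ p A : ℝ) (y : ℝ) : ℝ :=
  min (A * y / σ ^ 2 - A ^ 2 / (2 * σ ^ 2)) (-log p) - log 2

@[fun_prop]
lemma tst_meas (σ p A : ℝ) : Measurable (tst σ p A) := by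
  unfold tst; fun_prop

lemma tst_lint (σ p A : ℝ) (hσ : 0 < σ) (v : NNReal) (hvσ : (v : ℝ) = σ ^ 2) (hp : 0 < p) (hp1 : p ≤ 1) :
    ∫⁻ x, (∫⁻ z, ENNReal.ofReal (exp (tst σ p A (x + z)))
      ∂(gaussianReal 0 v)) ∂(onoff p A) ≤ 1 := by
  set N := gaussianReal 0 v with hN
  have hm : Measurable (fun y => ENNReal.ofReal (exp (tst σ p A y))) :=
    (tst_meas σ p A).exp.ennreal_ofReal
  rw [lintegral_onoff, gauss_shift σ hσ v hvσ A (fun y => ENNReal.ofReal (exp (tst σ p A y))) hm, ← hN,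
    ← lintegral_const_mul _ (by fun_prop), ← lintegral_const_mul _ (by fun_prop),
    ← lintegral_add_left (by fun_prop)]
  calc _ ≤ ∫⁻ z, ENNReal.ofReal (exp (A * z / σ ^ 2 - A ^ 2 / (2 * σ ^ 2))) * 1 ∂N := by
        apply lintegral_mono
        intro z
        simp only [zero_add, mul_one]
        rw [← ENNReal.ofReal_mul (exp_pos _).le, ← ENNReal.ofReal_mul (sub_nonneg.2 hp1),
          ← ENNReal.ofReal_mul hp.le, ← ENNReal.ofReal_add (by
            have : 0 ≤ 1 - p := by linarith
            positivity) (by positivity)]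
        apply ENNReal.ofReal_le_ofReal
        unfold tst
        set W := A * z / σ ^ 2 - A ^ 2 / (2 * σ ^ 2)
        have e1 : exp (min W (-log p) - log 2) ≤ exp W / 2 := by
          rw [Real.exp_sub, Real.exp_log two_pos]
          gcongr
          exact min_le_left _ _
        have e2 : p * exp (min W (-log p) - log 2) ≤ 1 / 2 := by
          rw [Real.exp_sub, Real.exp_log two_pos]
          have : exp (min W (-log p)) ≤ p⁻¹ := by
            rw [← Real.exp_log (inv_pos.2 hp), Real.log_inv]
            gcongr
            exact min_le_right _ _
          calc _ = p * exp (min W (-log p)) / 2 := by ring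
            _ ≤ p * p⁻¹ / 2 := by gcongr
            _ = 1 / 2 := by rw [mul_inv_cancel₀ hp.ne']
        have e3 : 0 < exp (min W (-log p) - log 2) := exp_pos _
        have e4 : 0 < exp W := exp_pos _
        nlinarith
    _ = 1 := by
        rw [← gauss_shift σ hσ v hvσ A (fun _ => 1) measurable_const]
        simp

lemma tst_int (σ p A : ℝ) (hσ : 0 < σ) (v : NNReal) (hvσ : (v : ℝ) = σ ^ 2)
    (hA : 0 < A) (hpA : A ^ 2 / (2 * σ ^ 2) ≤ -log p) :
    Integrable (fun z => tst σ p A (A + z)) (gaussianReal 0 v) ∧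
    A ^ 2 / (2 * σ ^ 2) - A / σ - log 2 ≤ ∫ z, tst σ p A (A + z) ∂(gaussianReal 0 v) := by
  have hm2 : MemLp (fun z : ℝ => z) 2 (gaussianReal 0 v) := memLp_id_gaussianReal 2
  have h1 : Integrable (fun z : ℝ => z) (gaussianReal 0 v) := hm2.integrable (by norm_num)
  have h2 : Integrable (fun z : ℝ => z ^ 2) (gaussianReal 0 v) := hm2.integrable_sq
  have hs : ∫ z : ℝ, z ^ 2 ∂(gaussianReal 0 v) = σ ^ 2 := by
    have := variance_fun_id_gaussianReal (μ := 0) (v := v)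
    rw [variance_of_integral_eq_zero (by fun_prop) (by simp)] at this
    rw [← hvσ, ← this]
  have hi : Integrable (fun z => tst σ p A (A + z)) (gaussianReal 0 v) := by
    unfold tst
    refine Integrable.sub (Integrable.inf ?_ (integrable_const _)) (integrable_const _)
    have : (fun z => A * (A + z) / σ ^ 2 - A ^ 2 / (2 * σ ^ 2)) =
      (fun z => (A / σ ^ 2) * z + (A * A / σ ^ 2 - A ^ 2 / (2 * σ ^ 2))) := by
      ext z; ring
    rw [this]
    exact (h1.const_mul _).add (integrable_const _)
  refine ⟨hi, ?_⟩
  have hlow : Integrable (fun z : ℝ => (A ^ 2 / (2 * σ ^ 2) - A / (2 * σ) - log 2)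
      - A / (2 * σ ^ 3) * z ^ 2) (gaussianReal 0 v) :=
    (integrable_const _).sub (h2.const_mul _)
  calc A ^ 2 / (2 * σ ^ 2) - A / σ - log 2
      = ∫ z : ℝ, ((A ^ 2 / (2 * σ ^ 2) - A / (2 * σ) - log 2)
      - A / (2 * σ ^ 3) * z ^ 2) ∂(gaussianReal 0 v) := by
        rw [integral_sub (integrable_const _) (h2.const_mul _), integral_const_mul, hs]
        simp
        field_simp
        ring
    _ ≤ _ := by
        apply integral_mono hlow hi
        intro z
        simp only [tst]
        have key : A ^ 2 / (2 * σ ^ 2) - A / (2 * σ) - A / (2 * σ ^ 3) * z ^ 2 ≤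
            min (A * (A + z) / σ ^ 2 - A ^ 2 / (2 * σ ^ 2)) (-log p) := by
          apply le_min
          · have : A * (A + z) / σ ^ 2 - A ^ 2 / (2 * σ ^ 2) - (A ^ 2 / (2 * σ ^ 2) - A / (2 * σ)
              - A / (2 * σ ^ 3) * z ^ 2) = A / (2 * σ ^ 3) * (z + σ) ^ 2 := by
              field_simp
              ring
            have : 0 ≤ A / (2 * σ ^ 3) * (z + σ) ^ 2 := by positivity
            linarith
          · have : 0 ≤ A / (2 * σ ^ 3) * z ^ 2 := by positivity
            have : 0 ≤ A / (2 * σ) := by positivity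
            linarith
        linarith

lemma mi_bound (σ p A : ℝ) (hσ : 0 < σ) (hp : 0 < p) (hp1 : p ≤ 1)
    (hA : 0 < A) (hpA : A ^ 2 / (2 * σ ^ 2) ≤ -log p) :
    ((p * (A ^ 2 / (2 * σ ^ 2) - A / σ - log 2) : ℝ) : EReal) ≤ mutualInfo σ (onoff p A) := by
  have := onoff_prob p A hp.le hp1
  obtain ⟨v, hvσ, hJ⟩ : ∃ v : NNReal, (v : ℝ) = σ ^ 2 ∧ jointLaw σ (onoff p A) =
    ((onoff p A).prod (gaussianReal 0 v)).map (fun q => (q.1, q.1 + q.2)) :=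
    ⟨⟨σ ^ 2, sq_nonneg σ⟩, rfl, rfl⟩
  have hmm : Measurable (fun q : ℝ × ℝ => (q.1, q.1 + q.2)) := by fun_prop
  have hfst : (jointLaw σ (onoff p A)).map Prod.fst = onoff p A := by
    rw [hJ, Measure.map_map measurable_fst hmm]
    change Measure.map Prod.fst _ = _
    simp
  have hsnd : (jointLaw σ (onoff p A)).map Prod.snd =
      ((onoff p A).prod (gaussianReal 0 v)).map (fun q => q.1 + q.2) := by
    rw [hJ, Measure.map_map measurable_snd hmm]
    rfl
  unfold mutualInfo
  rw [hfst]
  have hJp : IsProbabilityMeasure (jointLaw σ (onoff p A)) := by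
    rw [hJ]; exact Measure.isProbabilityMeasure_map hmm.aemeasurable
  have hYp : IsProbabilityMeasure ((jointLaw σ (onoff p A)).map Prod.snd) :=
    Measure.isProbabilityMeasure_map measurable_snd.aemeasurable
  unfold klDiv
  split_ifs with h
  swap
  · exact le_top
  obtain ⟨hac, hint⟩ := h
  rw [EReal.coe_le_coe_iff]
  set g : ℝ × ℝ → ℝ := fun q => if q.1 = A then tst σ p A q.2 else 0 with hgdef
  have hg : Measurable g := by
    apply Measurable.ite
    · exact measurable_fst (measurableSet_singleton A)
    · fun_prop
    · fun_prop
  obtain ⟨ti, tb⟩ := tst_int σ p A hσ v hvσ hA hpA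
  have hg' : Measurable (fun q : ℝ × ℝ => g (q.1, q.1 + q.2)) := hg.comp hmm
  have hgi' : Integrable (fun q : ℝ × ℝ => g (q.1, q.1 + q.2))
      ((onoff p A).prod (gaussianReal 0 v)) := by
    have hk : ∀ x : ℝ, Integrable (fun z => g (x, x + z)) (gaussianReal 0 v) := by
      intro x
      by_cases hx : x = A
      · subst hx; simpa [hgdef] using ti
      · simp [hgdef, hx]
    rw [integrable_prod_iff hg'.aestronglyMeasurable]
    refine ⟨ae_of_all _ hk, ?_⟩
    have hh (a : ℝ) : Integrable (fun x => ∫ z, ‖g (x, x + z)‖ ∂(gaussianReal 0 v))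
      (Measure.dirac a) := integrable_dirac (by simp)
    exact ((hh 0).smul_measure (by simp)).add_measure ((hh A).smul_measure (by simp))
  have hgi : Integrable g (jointLaw σ (onoff p A)) := by
    rw [hJ, integrable_map_measure hg.aestronglyMeasurable hmm.aemeasurable]
    exact hgi'
  have hval : ∫ q, g q ∂(jointLaw σ (onoff p A)) =
      p * ∫ z, tst σ p A (A + z) ∂(gaussianReal 0 v) := by
    rw [hJ, integral_map hmm.aemeasurable hg.aestronglyMeasurable, integral_prod _ hgi',
      integral_onoff p A hp.le hp1]
    simp [hgdef, hA.ne]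
  refine le_trans ?_ (dv_bound _ _ hac hint g hg hgi ?_)
  · rw [hval]
    gcongr
  · rw [lintegral_prod _ (by fun_prop), lintegral_onoff]
    have e0 : ∫⁻ y, ENNReal.ofReal (exp (g (0, y))) ∂((jointLaw σ (onoff p A)).map Prod.snd)
        = 1 := by
      simp [hgdef, hA.ne]
    have e1 : ∫⁻ y, ENNReal.ofReal (exp (g (A, y))) ∂((jointLaw σ (onoff p A)).map Prod.snd)
        ≤ 1 := by
      rw [hsnd, lintegral_map (by fun_prop) (by fun_prop), lintegral_prod _ (by fun_prop)]
      simpa [hgdef] using tst_lint σ p A hσ v hvσ hp hp1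
    rw [e0]
    calc _ ≤ ENNReal.ofReal (1 - p) * 1 + ENNReal.ofReal p * 1 := by gcongr
      _ = 1 := by
        rw [mul_one, mul_one, ← ENNReal.ofReal_add (by linarith) hp.le]
        simp

lemma cap_bound (σ E : ℝ) (hσ : 0 < σ) (hE : 0 < E) (hL : 1 ≤ log (σ / E)) :
    ((E / σ * (√(2 * log (σ / E)) / 2 - 1 - log 2) : ℝ) : EReal) ≤ capacityAvg σ E := by
  set a := √(2 * log (σ / E)) with ha
  have ha1 : 1 ≤ a := by
    rw [ha, Real.one_le_sqrt]; linarith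
  have ha2 : a ^ 2 = 2 * log (σ / E) := Real.sq_sqrt (by linarith)
  have ha0 : 0 < a := by linarith
  set p := E / (σ * a) with hpdef
  have hp : 0 < p := by positivity
  have hple : p ≤ E / σ := by
    rw [hpdef]
    gcongr
    nlinarith
  have hlogp : log p ≤ - log (σ / E) := by
    rw [← Real.log_inv, inv_div]
    exact Real.log_le_log hp hple
  have hp1 : p ≤ 1 := by
    by_contra hc
    have := Real.log_pos (not_le.1 hc)
    linarith
  have hb := mi_bound σ p (σ * a) hσ hp hp1 (by positivity) (by
    have : (σ * a) ^ 2 / (2 * σ ^ 2) = a ^ 2 / 2 := by field_simp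
    rw [this, ha2]; linarith)
  have := onoff_prob p (σ * a) hp.le hp1
  have hmem : onoff p (σ * a) ∈ {Q : Measure ℝ | IsProbabilityMeasure Q ∧ Q (Set.Ici 0) = 1 ∧
      ∫⁻ x, ENNReal.ofReal x ∂Q ≤ ENNReal.ofReal E} := by
    refine ⟨this, ?_, ?_⟩
    · have h0 : (0 : ℝ) ≤ σ * a := by positivity
      rw [← lintegral_indicator_one measurableSet_Ici, lintegral_onoff]
      simp only [Set.indicator, Set.mem_Ici, h0, le_refl, if_true, Pi.one_apply, mul_one]
      rw [← ENNReal.ofReal_add (by linarith) hp.le]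
      simp
    · rw [lintegral_onoff, ← ENNReal.ofReal_mul hp.le]
      simp only [ENNReal.ofReal_zero, mul_zero, zero_add]
      apply ENNReal.ofReal_le_ofReal
      rw [hpdef]
      apply le_of_eq
      field_simp
  refine le_trans ?_ (le_trans hb (le_iSup₂_of_le (onoff p (σ * a)) hmem le_rfl))
  rw [EReal.coe_le_coe_iff]
  have e : p * ((σ * a) ^ 2 / (2 * σ ^ 2) - σ * a / σ - log 2) =
      E / σ * (a / 2 - 1 - log 2 / a) := by
    rw [hpdef]; field_simp
  rw [e]
  have : log 2 / a ≤ log 2 := div_le_self (Real.log_nonneg (by norm_num)) ha1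
  have h3 : 0 < E / σ := by positivity
  apply mul_le_mul_of_nonneg_left _ h3.le
  linarith

/-- Low-power asymptotics (lower part) of the average-power-constrained capacity:
`liminf_{E → 0⁺} C(E)/((E/σ)√(log(σ/E))) ≥ 1/√2`. -/
theorem capacityAvg_low_power_liminf (σ : ℝ) (hσ : 0 < σ) :
    ((1 / Real.sqrt 2 : ℝ) : EReal) ≤
      Filter.liminf
        (fun E : ℝ => capacityAvg σ E / ((E / σ * Real.sqrt (Real.log (σ / E)) : ℝ) : EReal))
        (𝓝[>] 0) := by
  have hlog : Tendsto (fun E : ℝ => log (σ / E)) (𝓝[>] 0) atTop := by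
    have h0 : Tendsto (fun E : ℝ => σ / E) (𝓝[>] 0) atTop := by
      simp only [div_eq_mul_inv]
      exact tendsto_inv_nhdsGT_zero.const_mul_atTop hσ
    exact Real.tendsto_log_atTop.comp h0
  have hs : Tendsto (fun E : ℝ => √(log (σ / E))) (𝓝[>] 0) atTop :=
    Real.tendsto_sqrt_atTop.comp hlog
  have hlim : Tendsto (fun E : ℝ => 1 / √2 - (1 + log 2) / √(log (σ / E))) (𝓝[>] 0)
      (𝓝 (1 / √2)) := by
    simpa using (tendsto_const_nhds (x := 1 / √2)).sub (hs.const_div_atTop (1 + log 2))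
  have hlim' : Tendsto (fun E : ℝ => ((1 / √2 - (1 + log 2) / √(log (σ / E)) : ℝ) : EReal))
      (𝓝[>] 0) (𝓝 ((1 / √2 : ℝ) : EReal)) :=
    (continuous_coe_real_ereal.tendsto _).comp hlim
  rw [← hlim'.liminf_eq]
  refine Filter.liminf_le_liminf ?_
  filter_upwards [hlog.eventually_ge_atTop 1, self_mem_nhdsWithin] with E hL hE
  have hE : 0 < E := hE
  have hsp : 0 < √(log (σ / E)) := Real.sqrt_pos.2 (by linarith)
  have hd : 0 < E / σ * √(log (σ / E)) := by positivity
  rw [EReal.le_div_iff_mul_le (by exact_mod_cast hd) (EReal.coe_ne_top _)]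
  refine le_trans (le_of_eq ?_) (cap_bound σ E hσ hE hL)
  rw [← EReal.coe_mul]
  congr 1
  rw [Real.sqrt_mul (by norm_num)]
  have h2 : √2 * √2 = 2 := Real.mul_self_sqrt (by norm_num)
  have h2' : 1 / √2 = √2 / 2 := by
    have : 0 < √2 := by positivity
    field_simp
    linarith
  rw [h2']
  field_simp
  ring
end

section
/- The function g : (0, ∞) → ℝ defined by g(μ) := 1/μ − e^{−μ}/(1 − e^{−μ}) is strictly monotonically decreasing on (0, ∞), tends to 1/2 as μ → 0⁺, and tends to 0 as μ → ∞. Consequently, for every α with 0 < α < 1/2 there exists a unique μ* > 0 satisfying α = 1/μ* − e^{−μ*}/(1 − e^{−μ*}). -/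
open Real Filter Topology

lemma g_den_pos {x : ℝ} (hx : 0 < x) : 0 < 1 - rexp (-x) := by
  have : rexp (-x) < 1 := Real.exp_lt_one_iff.2 (by linarith)
  linarith

lemma g_hasDeriv {x : ℝ} (hx : 0 < x) :
    HasDerivAt (fun μ : ℝ => 1 / μ - rexp (-μ) / (1 - rexp (-μ)))
      (-1 / x ^ 2 + rexp (-x) / (1 - rexp (-x)) ^ 2) x := by
  have hd := (g_den_pos hx).ne'
  have he : HasDerivAt (fun μ : ℝ => rexp (-μ)) (rexp (-x) * (-1)) x :=
    (hasDerivAt_neg x).exp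
  have h1 : HasDerivAt (fun μ : ℝ => 1 / μ) (-1 / x ^ 2) x := by
    simpa [neg_div] using hasDerivAt_inv hx.ne'
  have h2 := he.div (he.const_sub 1) hd
  refine (h1.sub h2).congr_deriv ?_
  field_simp
  ring

lemma g_deriv_neg {x : ℝ} (hx : 0 < x) :
    -1 / x ^ 2 + rexp (-x) / (1 - rexp (-x)) ^ 2 < 0 := by
  have hd := g_den_pos hx
  have h := Real.self_lt_sinh_iff.2 (half_pos hx)
  rw [Real.sinh_eq] at h
  have hp := Real.exp_pos (-(x/2))
  have e1 : rexp (-x) = rexp (-(x/2)) * rexp (-(x/2)) := by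
    rw [← Real.exp_add]; ring_nf
  have e2 : rexp (x/2) * rexp (-(x/2)) = 1 := by
    rw [← Real.exp_add]; simp
  have h3 : x * rexp (-(x/2)) < 1 - rexp (-x) := by
    rw [e1]
    nlinarith
  have h4 : (x * rexp (-(x/2))) ^ 2 < (1 - rexp (-x)) ^ 2 :=
    pow_lt_pow_left₀ h3 (by positivity) (by norm_num)
  have h5 : rexp (-x) / (1 - rexp (-x)) ^ 2 < 1 / x ^ 2 := by
    rw [div_lt_div_iff₀ (by positivity) (by positivity)]
    calc _ = (x * rexp (-(x/2))) ^ 2 := by rw [e1]; ring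
      _ < _ := by linarith
  rw [neg_div]; linarith

lemma g_anti :
    StrictAntiOn (fun μ : ℝ => 1 / μ - rexp (-μ) / (1 - rexp (-μ))) (Set.Ioi 0) := by
  apply strictAntiOn_of_deriv_neg (convex_Ioi 0)
  · intro x hx
    exact (g_hasDeriv hx).continuousAt.continuousWithinAt
  · intro x hx
    rw [interior_Ioi] at hx
    rw [(g_hasDeriv hx).deriv]
    exact g_deriv_neg hx

lemma g_zero :
    Tendsto (fun μ : ℝ => 1 / μ - rexp (-μ) / (1 - rexp (-μ))) (𝓝[>] 0) (𝓝 (1 / 2)) := by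
  have hid : Tendsto (fun x : ℝ => x) (𝓝[>] 0) (𝓝 0) := tendsto_nhdsWithin_of_tendsto_nhds tendsto_id
  have hs : ∀ᶠ x : ℝ in 𝓝[>] 0, 0 < x ∧ x < 1 := Ioo_mem_nhdsGT one_pos
  have key : ∀ x : ℝ, 0 < x → x < 1 → |rexp x - 1 - x - x^2/2| ≤ x^3 := by
    intro x h0 h1
    have := Real.exp_bound (x := x) (by rw [abs_of_pos h0]; exact h1.le) (n := 3) (by norm_num)
    norm_num [Finset.sum_range_succ, Nat.factorial, abs_of_pos h0] at this
    have h3 : 0 < x^3 := by positivity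
    calc _ = |rexp x - (1 + x + x^2/2)| := by ring_nf
      _ ≤ _ := this
      _ ≤ _ := by linarith
  have hN : Tendsto (fun x : ℝ => (rexp x - 1 - x) / x^2) (𝓝[>] 0) (𝓝 (1/2)) := by
    rw [tendsto_iff_norm_sub_tendsto_zero]
    refine squeeze_zero' (Eventually.of_forall fun _ => norm_nonneg _) ?_ hid
    filter_upwards [hs] with x ⟨h0, h1⟩
    have e : (rexp x - 1 - x) / x^2 - 1/2 = (rexp x - 1 - x - x^2/2) / x^2 := by
      field_simp
    rw [e, Real.norm_eq_abs, abs_div, abs_of_pos (pow_pos h0 2), div_le_iff₀ (pow_pos h0 2)]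
    calc _ ≤ _ := key x h0 h1
      _ = _ := by ring
  have hD : Tendsto (fun x : ℝ => 1 + x * ((rexp x - 1 - x) / x^2)) (𝓝[>] 0) (𝓝 (1 + 0 * (1/2))) :=
    (hid.mul hN).const_add 1
  have := hN.div hD (by norm_num)
  norm_num only [] at this
  refine Tendsto.congr' ?_ this
  filter_upwards [hs] with x ⟨h0, h1⟩
  have hE : 1 < rexp x := Real.one_lt_exp_iff.2 h0
  have hE' : rexp x - 1 ≠ 0 := by linarith
  have e : 1 + x * ((rexp x - 1 - x) / x^2) = (rexp x - 1) / x := by field_simp; ring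
  have e2 : rexp (-x) / (1 - rexp (-x)) = 1 / (rexp x - 1) := by
    have hd := (g_den_pos h0).ne'
    rw [div_eq_div_iff hd hE', Real.exp_neg]
    field_simp
  simp only [Pi.div_apply]
  rw [e, e2]
  field_simp

lemma g_top :
    Tendsto (fun μ : ℝ => 1 / μ - rexp (-μ) / (1 - rexp (-μ))) atTop (𝓝 0) := by
  have he : Tendsto (fun x : ℝ => rexp (-x)) atTop (𝓝 0) := Real.tendsto_exp_neg_atTop_nhds_zero
  have h1 : Tendsto (fun x : ℝ => 1 / x) atTop (𝓝 0) := by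
    simpa using tendsto_inv_atTop_zero (𝕜 := ℝ)
  have := h1.sub (he.div (he.const_sub 1) (by norm_num))
  simpa using this


/-- The function `g(μ) = 1/μ − e^{−μ}/(1 − e^{−μ})` is strictly decreasing on
`(0, ∞)`, tends to `1/2` as `μ → 0⁺` and to `0` as `μ → ∞`; consequently, for
every `0 < α < 1/2` there is a unique `μ* > 0` with
`α = 1/μ* − e^{−μ*}/(1 − e^{−μ*})`. -/
theorem g_strictAnti_limits_and_unique_solution :
    StrictAntiOn (fun μ : ℝ => 1 / μ - rexp (-μ) / (1 - rexp (-μ))) (Set.Ioi 0) ∧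
    Tendsto (fun μ : ℝ => 1 / μ - rexp (-μ) / (1 - rexp (-μ))) (𝓝[>] 0) (𝓝 (1 / 2)) ∧
    Tendsto (fun μ : ℝ => 1 / μ - rexp (-μ) / (1 - rexp (-μ))) atTop (𝓝 0) ∧
    ∀ α : ℝ, 0 < α → α < 1 / 2 →
      ∃! μ : ℝ, 0 < μ ∧ α = 1 / μ - rexp (-μ) / (1 - rexp (-μ)) := by
  refine ⟨g_anti, g_zero, g_top, fun α h0 h1 => ?_⟩
  have hc : ContinuousOn (fun μ : ℝ => 1 / μ - rexp (-μ) / (1 - rexp (-μ))) (Set.Ioi 0) :=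
    fun x hx => (g_hasDeriv hx).continuousAt.continuousWithinAt
  obtain ⟨m, hm, hma⟩ := isPreconnected_Ioi.intermediate_value_Ioo
    (le_principal_iff.2 (Ioi_mem_atTop (0 : ℝ))) (le_principal_iff.2 self_mem_nhdsWithin)
    hc g_top g_zero ⟨h0, h1⟩
  refine ⟨m, ⟨hm, hma.symm⟩, ?_⟩
  rintro y ⟨hy, hya⟩
  exact g_anti.injOn hy hm (hya.symm.trans hma.symm)
end
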